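/- arXiv:2212.11748 — 3 statements merged into one kernel-verified Lean document; each statement's English description precedes it below -/
import Mathlib

section
/- Let T be a nondegenerate tetrahedron and P₃⁻(T) = P₂(T) + span{λ₁²λ₂, λ₂²λ₃, λ₃²λ₁}. If v ∈ P₃⁻(T) satisfies ∫_F v q ds = 0 for all q ∈ P₁(F) on every face F of T, then v is a scalar multiple of 𝔟₂ = 2 − 4∑_{i=1}^4 λᵢ²; in particular v ∈ P₂(T). -/
open MeasureTheory MvPolynomial
open scoped RealInnerProductSpace

noncomputable section

/-- Euclidean 3-space. -/
abbrev E3 := EuclideanSpace ℝ (Fin 3)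

/-- Evaluate a polynomial in 3 variables at a point of `E3`. -/
def evalP (x : E3) (p : MvPolynomial (Fin 3) ℝ) : ℝ :=
  MvPolynomial.eval (fun j => x j) p

/-- The (closed) facet of the tetrahedron opposite to vertex `i`. -/
def face (a : Fin 4 → E3) (i : Fin 4) : Set E3 :=
  convexHull ℝ (a '' {j | j ≠ i})

/-- The (closed) tetrahedron with vertices `a`. -/
def tetra (a : Fin 4 → E3) : Set E3 :=
  convexHull ℝ (Set.range a)

/-- The reduced cubic space `P₃⁻(T) = P₂(T) + span{λ₁²λ₂, λ₂²λ₃, λ₃²λ₁}`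
(vertex indices `0,1,2,3`). -/
def P3minus (lam : Fin 4 → MvPolynomial (Fin 3) ℝ) : Set (MvPolynomial (Fin 3) ℝ) :=
  {w | ∃ (p : MvPolynomial (Fin 3) ℝ) (c₁ c₂ c₃ : ℝ), p.totalDegree ≤ 2 ∧
    w = p + c₁ • (lam 0 ^ 2 * lam 1) + c₂ • (lam 1 ^ 2 * lam 2) + c₃ • (lam 2 ^ 2 * lam 0)}


open Set in
/-- The standard triangle. -/
def stdTri : Set (ℝ × ℝ) := {p | 0 ≤ p.1 ∧ 0 ≤ p.2 ∧ p.1 + p.2 ≤ 1}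

/-- The parametrisation of the triangle. -/
def triMap (A B C : E3) (p : ℝ × ℝ) : E3 := (1 - p.1 - p.2) • A + p.1 • B + p.2 • C

lemma isClosed_stdTri : IsClosed stdTri := by
  refine IsClosed.inter (s₁ := {p : ℝ × ℝ | 0 ≤ p.1}) ?_
    (IsClosed.inter (s₁ := {p : ℝ × ℝ | 0 ≤ p.2}) (s₂ := {p : ℝ × ℝ | p.1 + p.2 ≤ 1}) ?_ ?_)
  · exact isClosed_le (by fun_prop) (by fun_prop)
  · exact isClosed_le (by fun_prop) (by fun_prop)
  · exact isClosed_le (by fun_prop) (by fun_prop)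

lemma isCompact_stdTri : IsCompact stdTri := by
  refine (isCompact_Icc (a := ((0, 0) : ℝ × ℝ)) (b := (1, 1))).of_isClosed_subset isClosed_stdTri ?_
  rintro ⟨x, y⟩ ⟨h1, h2, h3⟩
  simp only at h1 h2 h3
  refine ⟨⟨h1, h2⟩, ⟨?_, ?_⟩⟩ <;> simp only <;> linarith

lemma hull_eq (A B C : E3) : convexHull ℝ {A, B, C} = triMap A B C '' stdTri := by
  apply Set.Subset.antisymm
  · apply convexHull_min
    · rintro x (rfl | rfl | rfl)
      · exact ⟨(0, 0), by simp [stdTri], by simp [triMap]⟩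
      · exact ⟨(1, 0), by simp [stdTri], by simp [triMap]⟩
      · exact ⟨(0, 1), by simp [stdTri], by simp [triMap]⟩
    · rintro _ ⟨⟨x, y⟩, ⟨h1, h2, h3⟩, rfl⟩ _ ⟨⟨x', y'⟩, ⟨h1', h2', h3'⟩, rfl⟩ s t hs ht hst
      simp only at h1 h2 h3 h1' h2' h3'
      refine ⟨(s * x + t * x', s * y + t * y'), ⟨by simp only; positivity, by simp only; positivity, ?_⟩, ?_⟩
      · simp only
        nlinarith
      · simp only [triMap]
        have : t = 1 - s := by linarith
        subst this
        module
  · rintro _ ⟨⟨x, y⟩, ⟨h1, h2, h3⟩, rfl⟩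
    simp only at h1 h2 h3
    have hA : A ∈ convexHull ℝ {A, B, C} := subset_convexHull _ _ (by simp)
    have hB : B ∈ convexHull ℝ {A, B, C} := subset_convexHull _ _ (by simp)
    have hC : C ∈ convexHull ℝ {A, B, C} := subset_convexHull _ _ (by simp)
    have := (convex_convexHull ℝ {A, B, C}).sum_mem (t := Finset.univ)
      (w := ![1 - x - y, x, y]) (z := ![A, B, C])
      (by intro i _; fin_cases i <;> simp <;> linarith)
      (by simp [Fin.sum_univ_three]; ring)
      (by intro i _; fin_cases i <;> simp [hA, hB, hC])
    simpa [Fin.sum_univ_three, triMap] using this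

/-- linear part -/
def triLin (A B C : E3) : ℝ × ℝ →ₗ[ℝ] E3 :=
  (LinearMap.fst ℝ ℝ ℝ).smulRight (B - A) + (LinearMap.snd ℝ ℝ ℝ).smulRight (C - A)

lemma triMap_eq (A B C : E3) (p : ℝ × ℝ) : triMap A B C p = A + triLin A B C p := by
  simp [triMap, triLin]
  module

lemma moment_transfer (A B C : E3) (hinj : Function.Injective (triLin A B C)) (f : E3 → ℝ)
    (h : ∫ x in convexHull ℝ {A, B, C}, f x ∂(μH[2]) = 0) :
    ∫ p in stdTri, f (triMap A B C p) = 0 := by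
  obtain ⟨K, K0, hK⟩ := (triLin A B C).exists_antilipschitzWith (LinearMap.ker_eq_bot.2 hinj)
  have hanti : AntilipschitzWith K (triMap A B C) := by
    intro x y
    rw [triMap_eq, triMap_eq, edist_add_left]
    exact hK x y
  have hlip : LipschitzWith ‖(LinearMap.toContinuousLinearMap (triLin A B C))‖₊ (triMap A B C) := by
    intro x y
    rw [triMap_eq, triMap_eq, edist_add_left]
    exact (LinearMap.toContinuousLinearMap (triLin A B C)).lipschitz x y
  have hemb : MeasurableEmbedding (triMap A B C) :=
    (hanti.isClosedEmbedding hlip.uniformContinuous).measurableEmbedding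
  set ν : Measure (ℝ × ℝ) := (μH[2] : Measure E3).comap (triMap A B C) with hν
  have hνa : ∀ s, ν s = μH[2] (triMap A B C '' s) := fun s => hemb.comap_apply _ s
  have i1 : ν.IsAddLeftInvariant := by
    refine ⟨fun g => ?_⟩
    ext s hs
    rw [Measure.map_apply (by fun_prop) hs, hνa, hνa]
    rw [← (IsometryEquiv.addLeft (triLin A B C g)).hausdorffMeasure_image]
    congr 1
    ext z
    constructor
    · rintro ⟨_, ⟨p, hp, rfl⟩, rfl⟩
      refine ⟨g + p, hp, ?_⟩
      simp [triMap_eq]; abel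
    · rintro ⟨p, hp, rfl⟩
      refine ⟨_, ⟨p - g, by simpa using hp, rfl⟩, ?_⟩
      simp [triMap_eq]; abel
  have i2 : IsFiniteMeasureOnCompacts ν := by
    refine ⟨fun s hs => ?_⟩
    rw [hνa]
    refine (hlip.hausdorffMeasure_image_le (by norm_num) s).trans_lt ?_
    rw [hausdorffMeasure_prod_real]
    exact ENNReal.mul_lt_top (ENNReal.rpow_lt_top_of_nonneg (by norm_num) (by simp)) hs.measure_lt_top
  have hsm := Measure.isAddLeftInvariant_eq_smul ν (volume : Measure (ℝ × ℝ))
  set c := Measure.addHaarScalarFactor ν (volume : Measure (ℝ × ℝ))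
  have hc : c ≠ 0 := by
    intro hc
    rw [hc, zero_smul] at hsm
    have h1 := hanti.le_hausdorffMeasure_image (d := 2) (by norm_num) Set.univ
    rw [← hνa, hsm, hausdorffMeasure_prod_real] at h1
    simp at h1
  rw [hull_eq, ← Measure.restrict_restrict_of_subset (Set.image_subset_range _ stdTri),
    ← hemb.map_comap, ← hν, hemb.setIntegral_map, hemb.injective.preimage_image, hsm] at h
  rw [Measure.restrict_smul, integral_smul_nnreal_measure] at h
  exact (smul_eq_zero.1 h).resolve_left hc

open Set in
lemma integral_stdTri (f : ℝ × ℝ → ℝ) (hf : Continuous f) :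
    ∫ p in stdTri, f p = ∫ x in (0:ℝ)..1, ∫ y in (0:ℝ)..(1 - x), f (x, y) := by
  have hm := isClosed_stdTri.measurableSet
  rw [← integral_indicator hm, Measure.volume_eq_prod, integral_prod]
  · rw [intervalIntegral.integral_of_le zero_le_one, ← integral_Icc_eq_integral_Ioc,
      ← integral_indicator measurableSet_Icc]
    congr 1
    ext x
    by_cases hx : x ∈ Icc (0:ℝ) 1
    · rw [indicator_of_mem hx, intervalIntegral.integral_of_le (by linarith [hx.2]),
        ← integral_Icc_eq_integral_Ioc, ← integral_indicator measurableSet_Icc]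
      congr 1
      ext y
      by_cases hy : y ∈ Icc (0:ℝ) (1 - x)
      · rw [indicator_of_mem hy, indicator_of_mem]
        exact ⟨hx.1, hy.1, by simp only; linarith [hy.2]⟩
      · rw [indicator_of_notMem hy, indicator_of_notMem]
        rintro ⟨h1, h2, h3⟩
        simp only at h1 h2 h3
        exact hy ⟨h2, by linarith⟩
    · rw [indicator_of_notMem hx]
      convert integral_zero ℝ ℝ using 2
      ext y
      rw [indicator_of_notMem]
      rintro ⟨h1, h2, h3⟩
      simp only at h1 h2 h3
      exact hx ⟨h1, by linarith⟩
  · rw [integrable_indicator_iff hm]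
    exact hf.continuousOn.integrableOn_compact isCompact_stdTri

/-- cubic form on triangle in barycentric coordinates -/
def cub (D E K : Fin 3 → ℝ) (t0 t1 t2 : ℝ) : ℝ :=
  D 0 * t0 ^ 2 + D 1 * t1 ^ 2 + D 2 * t2 ^ 2 + E 0 * (t0 * t1) + E 1 * (t1 * t2) + E 2 * (t2 * t0)
    + K 0 * (t0 ^ 2 * t1) + K 1 * (t1 ^ 2 * t2) + K 2 * (t2 ^ 2 * t0)

lemma int_mono (a b : ℕ) : ∫ p in stdTri, p.1 ^ a * p.2 ^ b
    = (a.factorial * b.factorial : ℝ) / (a + b + 2).factorial := by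
  have key : ∀ (b a : ℕ), ∫ x in (0:ℝ)..1, x ^ a * (1 - x) ^ b
      = (a.factorial * b.factorial : ℝ) / (a + b + 1).factorial := by
    intro b
    induction b with
    | zero =>
      intro a
      simp [Nat.factorial_succ]
      field_simp
    | succ b ih =>
      intro a
      have h1 : ∀ x ∈ Set.uIcc (0:ℝ) 1, HasDerivAt (fun x : ℝ => x ^ (a + 1) / (a + 1)) (x ^ a) x := by
        intro x _
        have := (hasDerivAt_pow (a + 1) x).div_const ((a : ℝ) + 1)
        convert! this using 1
        push_cast
        field_simp
        try simp
      have h2 : ∀ x ∈ Set.uIcc (0:ℝ) 1, HasDerivAt (fun x : ℝ => (1 - x) ^ (b + 1))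
          (-((b + 1) * (1 - x) ^ b)) x := by
        intro x _
        have := ((hasDerivAt_id x).const_sub 1).pow (b + 1)
        convert! this using 1
        push_cast
        simp
      have := intervalIntegral.integral_mul_deriv_eq_deriv_mul h2 h1
        ((by fun_prop : Continuous fun x : ℝ => -((b + 1) * (1 - x) ^ b)).intervalIntegrable _ _)
        ((by fun_prop : Continuous fun x : ℝ => x ^ a).intervalIntegrable _ _)
      have e1 : ∫ x in (0:ℝ)..1, x ^ a * (1 - x) ^ (b + 1) =
          ∫ x in (0:ℝ)..1, (1 - x) ^ (b + 1) * x ^ a := by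
        congr 1; ext x; ring
      have e2 : ∫ x in (0:ℝ)..1, -((b + 1) * (1 - x) ^ b) * (x ^ (a + 1) / (a + 1)) =
          (-((b:ℝ) + 1) / (a + 1)) * ∫ x in (0:ℝ)..1, x ^ (a + 1) * (1 - x) ^ b := by
        rw [← intervalIntegral.integral_const_mul]
        congr 1; ext x; ring
      rw [e1, this, e2, ih]
      have : a + 1 + b + 1 = a + (b + 1) + 1 := by ring
      rw [this]
      simp [Nat.factorial_succ]
      field_simp
      ring
  rw [integral_stdTri _ (by fun_prop)]
  simp only [intervalIntegral.integral_const_mul, integral_pow]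
  have e : ∀ x : ℝ, x ^ a * (((1 - x) ^ (b + 1) - 0 ^ (b + 1)) / (b + 1))
      = (1 / (b + 1)) * (x ^ a * (1 - x) ^ (b + 1)) := by
    intro x; simp; ring
  simp only [e, intervalIntegral.integral_const_mul, key]
  have : a + (b + 1) + 1 = a + b + 2 := by ring
  rw [this]
  simp [Nat.factorial_succ]
  field_simp

lemma int_bary (a : ℕ) : ∀ b c : ℕ, ∫ p in stdTri, (1 - p.1 - p.2) ^ a * p.1 ^ b * p.2 ^ c
    = (a.factorial * b.factorial * c.factorial : ℝ) / (a + b + c + 2).factorial := by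
  induction a with
  | zero => intro b c; simpa using int_mono b c
  | succ a ih =>
    intro b c
    have hI : ∀ b c : ℕ, IntegrableOn
        (fun p : ℝ × ℝ => (1 - p.1 - p.2) ^ a * p.1 ^ b * p.2 ^ c) stdTri := fun b c =>
      (by fun_prop : Continuous fun p : ℝ × ℝ =>
        (1 - p.1 - p.2) ^ a * p.1 ^ b * p.2 ^ c).continuousOn.integrableOn_compact isCompact_stdTri
    have e : ∀ p : ℝ × ℝ, (1 - p.1 - p.2) ^ (a + 1) * p.1 ^ b * p.2 ^ c
        = (1 - p.1 - p.2) ^ a * p.1 ^ b * p.2 ^ c - (1 - p.1 - p.2) ^ a * p.1 ^ (b + 1) * p.2 ^ c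
          - (1 - p.1 - p.2) ^ a * p.1 ^ b * p.2 ^ (c + 1) := by
      intro p; ring
    simp only [e]
    have hs : IntegrableOn (fun p : ℝ × ℝ => (1 - p.1 - p.2) ^ a * p.1 ^ b * p.2 ^ c
        - (1 - p.1 - p.2) ^ a * p.1 ^ (b + 1) * p.2 ^ c) stdTri := (hI b c).sub (hI (b + 1) c)
    rw [integral_sub hs (hI b (c + 1)), integral_sub (hI b c) (hI (b + 1) c),
      ih, ih, ih]
    have e1 : a + (b + 1) + c + 2 = a + b + c + 2 + 1 := by ring
    have e2 : a + b + (c + 1) + 2 = a + b + c + 2 + 1 := by ring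
    have e3 : a + 1 + b + c + 2 = a + b + c + 2 + 1 := by ring
    rw [e1, e2, e3, Nat.factorial_succ (a + b + c + 2), Nat.factorial_succ a, Nat.factorial_succ b,
      Nat.factorial_succ c]
    have : ((a + b + c + 2).factorial : ℝ) ≠ 0 := by positivity
    push_cast
    field_simp
    ring

/-- value of the barycentric moments -/
def bI (a b c : ℕ) : ℝ := (a.factorial * b.factorial * c.factorial : ℝ) / (a + b + c + 2).factorial

lemma int_cub (D E K : Fin 3 → ℝ) (p q r : ℕ) :
    ∫ x in stdTri, cub D E K (1 - x.1 - x.2) x.1 x.2 * ((1 - x.1 - x.2) ^ p * x.1 ^ q * x.2 ^ r)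
    = D 0 * bI (p + 2) q r + D 1 * bI p (q + 2) r + D 2 * bI p q (r + 2)
      + E 0 * bI (p + 1) (q + 1) r + E 1 * bI p (q + 1) (r + 1) + E 2 * bI (p + 1) q (r + 1)
      + K 0 * bI (p + 2) (q + 1) r + K 1 * bI p (q + 2) (r + 1) + K 2 * bI (p + 1) q (r + 2) := by
  have key : ∀ k : Fin 9 → ℝ, ∀ e f g : Fin 9 → ℕ, ∫ x in stdTri, ∑ i, k i *
      ((1 - x.1 - x.2) ^ (e i) * x.1 ^ (f i) * x.2 ^ (g i)) = ∑ i, k i * bI (e i) (f i) (g i) := by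
    intro k e f g
    rw [integral_finsetSum]
    · refine Finset.sum_congr rfl fun i _ => ?_
      rw [integral_const_mul, int_bary, bI]
    · intro i _
      exact (by fun_prop : Continuous fun x : ℝ × ℝ => k i *
        ((1 - x.1 - x.2) ^ (e i) * x.1 ^ (f i) * x.2 ^ (g i))).continuousOn.integrableOn_compact
        isCompact_stdTri
  have := key ![D 0, D 1, D 2, E 0, E 1, E 2, K 0, K 1, K 2]
    ![p + 2, p, p, p + 1, p, p + 1, p + 2, p, p + 1]
    ![q, q + 2, q, q + 1, q + 1, q, q + 1, q + 2, q]
    ![r, r, r + 2, r, r + 1, r + 1, r, r + 1, r + 2]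
  simp [Fin.sum_univ_succ] at this
  simp only [← add_assoc] at this
  rw [← this]
  congr 1
  ext x
  simp only [cub]
  ring

lemma face_eqs (A B C : E3) (D E K : Fin 3 → ℝ)
    (f g₀ g₁ g₂ : E3 → ℝ)
    (hf : ∀ x : ℝ × ℝ, f (triMap A B C x) = cub D E K (1 - x.1 - x.2) x.1 x.2)
    (h₀ : ∀ x : ℝ × ℝ, g₀ (triMap A B C x) = 1 - x.1 - x.2)
    (h₁ : ∀ x : ℝ × ℝ, g₁ (triMap A B C x) = x.1)
    (h₂ : ∀ x : ℝ × ℝ, g₂ (triMap A B C x) = x.2)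
    (m₀ : ∫ x in convexHull ℝ {A, B, C}, f x * g₀ x ∂(μH[2]) = 0)
    (m₁ : ∫ x in convexHull ℝ {A, B, C}, f x * g₁ x ∂(μH[2]) = 0)
    (m₂ : ∫ x in convexHull ℝ {A, B, C}, f x * g₂ x ∂(μH[2]) = 0) :
    (36 * D 0 + 12 * D 1 + 12 * D 2 + 12 * E 0 + 6 * E 1 + 12 * E 2 + 6 * K 0 + 2 * K 1 + 4 * K 2 = 0)
    ∧ (36 * D 1 + 12 * D 2 + 12 * D 0 + 12 * E 1 + 6 * E 2 + 12 * E 0 + 6 * K 1 + 2 * K 2 + 4 * K 0 = 0)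
    ∧ (36 * D 2 + 12 * D 0 + 12 * D 1 + 12 * E 2 + 6 * E 0 + 12 * E 1 + 6 * K 2 + 2 * K 0 + 4 * K 1 = 0)
    := by
  have hinj : Function.Injective (triLin A B C) := by
    intro p q hpq
    have : triMap A B C p = triMap A B C q := by rw [triMap_eq, triMap_eq, hpq]
    ext
    · rw [← h₁ p, ← h₁ q, this]
    · rw [← h₂ p, ← h₂ q, this]
  have n₀ := moment_transfer A B C hinj _ m₀
  have n₁ := moment_transfer A B C hinj _ m₁
  have n₂ := moment_transfer A B C hinj _ m₂
  simp only [hf, h₀, h₁, h₂] at n₀ n₁ n₂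
  have k₀ := int_cub D E K 1 0 0
  have k₁ := int_cub D E K 0 1 0
  have k₂ := int_cub D E K 0 0 1
  simp only [pow_zero, pow_one, one_mul, mul_one] at k₀ k₁ k₂
  rw [n₀] at k₀
  rw [n₁] at k₁
  rw [n₂] at k₂
  simp [bI, Nat.factorial] at k₀ k₁ k₂
  refine ⟨?_, ?_, ?_⟩ <;> linarith

lemma deg_mem_pow (S : Submodule ℝ (MvPolynomial (Fin 3) ℝ)) (h1 : 1 ∈ S) (hX : ∀ j, X j ∈ S) (n : ℕ)
    (p : MvPolynomial (Fin 3) ℝ) (hp : p.totalDegree ≤ n) : p ∈ S ^ n := by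
  have hone : (1 : Submodule ℝ (MvPolynomial (Fin 3) ℝ)) ≤ S := by
    rw [Submodule.one_le]; exact h1
  have key : ∀ n : ℕ, ∀ s : Fin 3 →₀ ℕ, s.degree ≤ n → monomial s (1:ℝ) ∈ S ^ n := by
    intro n
    induction n with
    | zero =>
      intro s hs
      have : s = 0 := (Finsupp.degree_eq_zero_iff s).1 (Nat.le_zero.1 hs)
      subst this
      rw [pow_zero]
      exact Submodule.one_le.1 le_rfl
    | succ n ih =>
      intro s hs
      by_cases h0 : s = 0
      · subst h0
        exact Submodule.one_le.1 (one_le_pow₀ hone)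
      · obtain ⟨j, hj⟩ := Finsupp.ne_iff.1 h0
        have hle : Finsupp.single j 1 ≤ s := by
          simp at hj ⊢; omega
        obtain ⟨t, rfl⟩ := exists_add_of_le hle
        have ht : t.degree ≤ n := by
          simp [map_add] at hs; omega
        rw [show monomial (Finsupp.single j 1 + t) (1:ℝ) = X j * monomial t 1 by
          simp [X, monomial_mul], pow_succ']
        exact Submodule.mul_mem_mul (hX j) (ih t ht)
  rw [p.as_sum]
  refine Submodule.sum_mem _ fun s hs => ?_
  have : monomial s (coeff s p) = coeff s p • monomial s (1:ℝ) := by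
    simp [smul_monomial]
  rw [this]
  refine Submodule.smul_mem _ _ (key n s ?_)
  exact (le_totalDegree hs).trans hp

lemma aff_eval (W : Submodule ℝ (MvPolynomial (Fin 3) ℝ))
    (hW : W = Submodule.span ℝ (Set.range (Fin.cons 1 X : Fin 4 → MvPolynomial (Fin 3) ℝ)))
    (f : MvPolynomial (Fin 3) ℝ) (hf : f ∈ W) (A B C : E3) (x : ℝ × ℝ) :
    evalP (triMap A B C x) f = (1 - x.1 - x.2) * evalP A f + x.1 * evalP B f + x.2 * evalP C f := by
  subst hW
  induction hf using Submodule.span_induction with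
  | mem f h =>
    obtain ⟨i, rfl⟩ := h
    refine Fin.cases ?_ (fun i => ?_) i
    · simp [evalP]; ring
    · simp [evalP, triMap]
  | zero => simp [evalP]
  | add f g _ _ h1 h2 => simp only [evalP, map_add] at *; rw [h1, h2]; ring
  | smul c f _ h => simp only [evalP, smul_eval] at *; rw [h]; ring

lemma span_lam (a : Fin 4 → E3)
    (lam : Fin 4 → MvPolynomial (Fin 3) ℝ)
    (hdeg : ∀ i, (lam i).totalDegree ≤ 1)
    (hval : ∀ i j, evalP (a j) (lam i) = if i = j then 1 else 0) :
    Submodule.span ℝ (Set.range lam) =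
      Submodule.span ℝ (Set.range (Fin.cons 1 X : Fin 4 → MvPolynomial (Fin 3) ℝ)) := by
  have hli : LinearIndependent ℝ lam := by
    rw [Fintype.linearIndependent_iff]
    intro g hg i
    have := congrArg (evalP (a i)) hg
    simp only [evalP, map_sum, smul_eval, map_zero] at this
    simp only [evalP] at hval
    simpa [hval] using this
  have : FiniteDimensional ℝ (Submodule.span ℝ
      (Set.range (Fin.cons 1 X : Fin 4 → MvPolynomial (Fin 3) ℝ))) :=
    FiniteDimensional.span_of_finite ℝ (Set.finite_range _)
  apply Submodule.eq_of_le_of_finrank_le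
  · rw [Submodule.span_le]
    rintro _ ⟨i, rfl⟩
    have := deg_mem_pow (Submodule.span ℝ (Set.range (Fin.cons 1 X : Fin 4 → MvPolynomial (Fin 3) ℝ)))
      (Submodule.subset_span ⟨0, rfl⟩) (fun j => Submodule.subset_span ⟨j.succ, rfl⟩) 1 _ (hdeg i)
    simpa using this
  · rw [finrank_span_eq_card hli]
    exact finrank_range_le_card _

lemma quad_form (lam : Fin 4 → MvPolynomial (Fin 3) ℝ) (p : MvPolynomial (Fin 3) ℝ)
    (hp : p ∈ Submodule.span ℝ (Set.range lam) ^ 2) :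
    ∃ c : Fin 4 × Fin 4 → ℝ, ∑ i, c i • (lam i.1 * lam i.2) = p := by
  rw [pow_two, Submodule.span_mul_span] at hp
  rw [← Submodule.mem_span_range_iff_exists_fun]
  refine Submodule.span_mono ?_ hp
  rintro _ ⟨_, ⟨i, rfl⟩, _, ⟨j, rfl⟩, rfl⟩
  exact ⟨(i, j), rfl⟩

lemma face_lin (a : Fin 4 → E3)
    (lam : Fin 4 → MvPolynomial (Fin 3) ℝ)
    (hdeg : ∀ i, (lam i).totalDegree ≤ 1)
    (hval : ∀ i j, evalP (a j) (lam i) = if i = j then 1 else 0)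
    (v : MvPolynomial (Fin 3) ℝ)
    (hmom : ∀ (i : Fin 4) (q : MvPolynomial (Fin 3) ℝ), q.totalDegree ≤ 1 →
      ∫ x in face a i, evalP x v * evalP x q ∂(μH[2]) = 0)
    (i j k l : Fin 4) (hset : {m | m ≠ i} = ({j, k, l} : Set (Fin 4)))
    (hjk : j ≠ k) (hjl : j ≠ l) (hkl : k ≠ l) (D E K : Fin 3 → ℝ)
    (hv : ∀ x, evalP x (lam i) = 0 →
      evalP x v = cub D E K (evalP x (lam j)) (evalP x (lam k)) (evalP x (lam l))) :
    (36 * D 0 + 12 * D 1 + 12 * D 2 + 12 * E 0 + 6 * E 1 + 12 * E 2 + 6 * K 0 + 2 * K 1 + 4 * K 2 = 0)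
    ∧ (36 * D 1 + 12 * D 2 + 12 * D 0 + 12 * E 1 + 6 * E 2 + 12 * E 0 + 6 * K 1 + 2 * K 2 + 4 * K 0 = 0)
    ∧ (36 * D 2 + 12 * D 0 + 12 * D 1 + 12 * E 2 + 6 * E 0 + 12 * E 1 + 6 * K 2 + 2 * K 0 + 4 * K 1 = 0)
    := by
  have hface : face a i = convexHull ℝ {a j, a k, a l} := by
    rw [face, hset]; simp [Set.image_insert_eq]
  have hij : j ≠ i := by
    have : j ∈ {m | m ≠ i} := by rw [hset]; simp
    exact this
  have hik : k ≠ i := by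
    have : k ∈ {m | m ≠ i} := by rw [hset]; simp
    exact this
  have hil : l ≠ i := by
    have : l ∈ {m | m ≠ i} := by rw [hset]; simp
    exact this
  have hL : ∀ (m : Fin 4) (x : ℝ × ℝ), evalP (triMap (a j) (a k) (a l) x) (lam m) =
      (1 - x.1 - x.2) * (if m = j then 1 else 0) + x.1 * (if m = k then 1 else 0)
        + x.2 * (if m = l then 1 else 0) := by
    intro m x
    rw [aff_eval _ (span_lam a lam hdeg hval) (lam m) (Submodule.subset_span ⟨m, rfl⟩), hval, hval, hval]
  have h0 : ∀ x : ℝ × ℝ, evalP (triMap (a j) (a k) (a l) x) (lam j) = 1 - x.1 - x.2 := by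
    intro x; rw [hL]; simp [hjk, hjl]
  have h1 : ∀ x : ℝ × ℝ, evalP (triMap (a j) (a k) (a l) x) (lam k) = x.1 := by
    intro x; rw [hL]; simp [hjk.symm, hkl]
  have h2 : ∀ x : ℝ × ℝ, evalP (triMap (a j) (a k) (a l) x) (lam l) = x.2 := by
    intro x; rw [hL]; simp [hjl.symm, hkl.symm]
  have h3 : ∀ x : ℝ × ℝ, evalP (triMap (a j) (a k) (a l) x) (lam i) = 0 := by
    intro x; rw [hL]; simp [hij.symm, hik.symm, hil.symm]
  refine face_eqs (a j) (a k) (a l) D E K (fun x => evalP x v) (fun x => evalP x (lam j))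
    (fun x => evalP x (lam k)) (fun x => evalP x (lam l)) ?_ h0 h1 h2 ?_ ?_ ?_
  · intro x
    rw [hv _ (h3 x), h0, h1, h2]
  · rw [← hface]; exact hmom i _ (hdeg j)
  · rw [← hface]; exact hmom i _ (hdeg k)
  · rw [← hface]; exact hmom i _ (hdeg l)

/-- an element of `P₃⁻(T)` whose first-order facet moments all
vanish is a scalar multiple of `𝔟₂ = 2 − 4∑λᵢ²` (in particular it lies
in `P₂(T)`). -/
theorem stmt16 (a : Fin 4 → E3) (hind : AffineIndependent ℝ a)
    (lam : Fin 4 → MvPolynomial (Fin 3) ℝ)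
    (hdeg : ∀ i, (lam i).totalDegree ≤ 1)
    (hval : ∀ i j, evalP (a j) (lam i) = if i = j then 1 else 0)
    (v : MvPolynomial (Fin 3) ℝ) (hv : v ∈ P3minus lam)
    (hmom : ∀ (i : Fin 4) (q : MvPolynomial (Fin 3) ℝ), q.totalDegree ≤ 1 →
      ∫ x in face a i, evalP x v * evalP x q ∂(μH[2]) = 0) :
    ∃ c : ℝ, v = c • (2 - 4 * ∑ i, lam i ^ 2) := by
  obtain ⟨p, c₁, c₂, c₃, hp, hvp⟩ := hv
  have hspan := span_lam a lam hdeg hval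
  have one_mem : (1 : MvPolynomial (Fin 3) ℝ) ∈ Submodule.span ℝ (Set.range lam) := by
    rw [hspan]; exact Submodule.subset_span ⟨0, rfl⟩
  have X_mem : ∀ j, (X j : MvPolynomial (Fin 3) ℝ) ∈ Submodule.span ℝ (Set.range lam) := by
    intro j; rw [hspan]; exact Submodule.subset_span ⟨j.succ, rfl⟩
  have hsum : lam 0 + lam 1 + lam 2 + lam 3 = 1 := by
    obtain ⟨g, hg⟩ := Submodule.mem_span_range_iff_exists_fun ℝ |>.1 one_mem
    have hg1 : ∀ i, g i = 1 := by
      intro i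
      have := congrArg (evalP (a i)) hg
      simp only [evalP, map_sum, smul_eval, map_one] at this
      simp only [evalP] at hval
      simpa [hval] using this
    rw [← hg]
    simp [Fin.sum_univ_four, hg1]
  obtain ⟨e, he⟩ := quad_form lam p (deg_mem_pow _ one_mem X_mem 2 p hp)
  rw [Fintype.sum_prod_type] at he
  simp only [Fin.sum_univ_four] at he
  rw [← he] at hvp
  have hev : ∀ x, evalP x v = _ := fun x => congrArg (evalP x) hvp
  simp only [evalP, map_add, map_mul, map_pow, smul_eval] at hev
  obtain ⟨a1, a2, a3⟩ := face_lin a lam hdeg hval v hmom 3 0 1 2 (by ext m; fin_cases m <;> simp)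
    (by decide) (by decide) (by decide) ![e (0,0), e (1,1), e (2,2)]
    ![e (0,1) + e (1,0), e (1,2) + e (2,1), e (2,0) + e (0,2)] ![c₁, c₂, c₃] (by
      intro x hx
      simp only [evalP] at hx ⊢
      rw [hev x, hx]
      simp [cub]
      ring)
  obtain ⟨b1, b2, b3⟩ := face_lin a lam hdeg hval v hmom 0 1 2 3 (by ext m; fin_cases m <;> simp)
    (by decide) (by decide) (by decide) ![e (1,1), e (2,2), e (3,3)]
    ![e (1,2) + e (2,1), e (2,3) + e (3,2), e (3,1) + e (1,3)] ![c₂, 0, 0] (by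
      intro x hx
      simp only [evalP] at hx ⊢
      rw [hev x, hx]
      simp [cub]
      ring)
  obtain ⟨d1, d2, d3⟩ := face_lin a lam hdeg hval v hmom 1 2 0 3 (by ext m; fin_cases m <;> simp)
    (by decide) (by decide) (by decide) ![e (2,2), e (0,0), e (3,3)]
    ![e (2,0) + e (0,2), e (0,3) + e (3,0), e (3,2) + e (2,3)] ![c₃, 0, 0] (by
      intro x hx
      simp only [evalP] at hx ⊢
      rw [hev x, hx]
      simp [cub]
      ring)
  obtain ⟨f1, f2, f3⟩ := face_lin a lam hdeg hval v hmom 2 0 1 3 (by ext m; fin_cases m <;> simp)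
    (by decide) (by decide) (by decide) ![e (0,0), e (1,1), e (3,3)]
    ![e (0,1) + e (1,0), e (1,3) + e (3,1), e (3,0) + e (0,3)] ![c₁, 0, 0] (by
      intro x hx
      simp only [evalP] at hx ⊢
      rw [hev x, hx]
      simp [cub]
      ring)
  simp at a1 a2 a3 b1 b2 b3 d1 d2 d3 f1 f2 f3
  clear hev hmom he hp hspan
  have hc1 : c₁ = 0 := by linarith
  have hc2 : c₂ = 0 := by linarith
  have hc3 : c₃ = 0 := by linarith
  subst hc1 hc2 hc3
  have q1 : e (1,1) = e (0,0) := by linarith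
  have q2 : e (2,2) = e (0,0) := by linarith
  have q3 : e (3,3) = e (0,0) := by linarith
  have r1 : e (1,0) = -2 * e (0,0) - e (0,1) := by linarith
  have r2 : e (2,0) = -2 * e (0,0) - e (0,2) := by linarith
  have r3 : e (3,0) = -2 * e (0,0) - e (0,3) := by linarith
  have r4 : e (2,1) = -2 * e (0,0) - e (1,2) := by linarith
  have r5 : e (3,1) = -2 * e (0,0) - e (1,3) := by linarith
  have r6 : e (3,2) = -2 * e (0,0) - e (2,3) := by linarith
  refine ⟨-e (0,0) / 2, ?_⟩
  have h3 : (2 - 4 * ∑ i, lam i ^ 2 : MvPolynomial (Fin 3) ℝ)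
      = 2 * (lam 0 + lam 1 + lam 2 + lam 3) ^ 2 - 4 * ∑ i, lam i ^ 2 := by
    rw [hsum]; ring
  rw [hvp, q1, q2, q3, r1, r2, r3, r4, r5, r6, h3, Fin.sum_univ_four]
  have h4 : (2 * (lam 0 + lam 1 + lam 2 + lam 3) ^ 2
      - 4 * (lam 0 ^ 2 + lam 1 ^ 2 + lam 2 ^ 2 + lam 3 ^ 2) : MvPolynomial (Fin 3) ℝ) =
      (2:ℝ) • (-(lam 0 ^ 2 + lam 1 ^ 2 + lam 2 ^ 2 + lam 3 ^ 2) + (2:ℝ) • (lam 0 * lam 1 + lam 0 * lam 2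
      + lam 0 * lam 3 + lam 1 * lam 2 + lam 1 * lam 3 + lam 2 * lam 3)) := by
    simp only [smul_eq_C_mul, map_ofNat]
    ring
  rw [h4, mul_comm (lam 1) (lam 0), mul_comm (lam 2) (lam 0), mul_comm (lam 3) (lam 0),
    mul_comm (lam 2) (lam 1), mul_comm (lam 3) (lam 1), mul_comm (lam 3) (lam 2)]
  simp only [← pow_two]
  module
end
end

section
/- Let T be a nondegenerate tetrahedron with vertices a₁,…,a₄, edge midpoints a_{jk} = (aⱼ+aₖ)/2, facets Fᵢ opposite aᵢ with scaled outward normals ν_{Fᵢ} of magnitude 2|Fᵢ|. Let q ∈ P₂(T) and suppose ∫_T 𝔟₃ (ζ·∇q) dx = 0 for all ζ ∈ ℝ³, where 𝔟₃ = ∑ᵢ(9λᵢ² − 11λᵢ³) + 72∑_{i<j<k} λᵢλⱼλₖ. Then q(a_{12}) = q(a_{34}), q(a_{13}) = q(a_{24}), and q(a_{14}) = q(a_{23}). -/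
open MeasureTheory MvPolynomial
open scoped RealInnerProductSpace

noncomputable section

/-- The affine shear `x ↦ x + c x • v`. -/
def shr (c : E3 →ᵃ[ℝ] ℝ) (v : E3) : E3 →ᵃ[ℝ] E3 :=
  AffineMap.id ℝ E3 + ((LinearMap.toSpanSingleton ℝ E3 v).toAffineMap.comp c)

lemma shr_apply (c : E3 →ᵃ[ℝ] ℝ) (v x : E3) : shr c v x = x + c x • v := by
  simp [shr]

lemma coord_shift (b : AffineBasis (Fin 4) ℝ E3) (k i j : Fin 4) (x : E3) (t : ℝ) :
    b.coord k (x + t • (b j - b i))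
      = b.coord k x + t * ((if k = j then 1 else 0) - (if k = i then 1 else 0)) := by
  have h1 : x + t • (b j - b i) = t • (b j -ᵥ b i) +ᵥ x := by
    simp [add_comm]
  rw [h1, AffineMap.map_vadd, map_smul, AffineMap.linearMap_vsub]
  simp [AffineBasis.coord_apply, add_comm]

lemma cov (g : E3 →ᵃ[ℝ] E3) (hg : Function.Injective g) :
    ∃ d : ℝ, ∀ s : Set E3, MeasurableSet s → ∀ f : E3 → ℝ,
      ∫ x in g '' s, f x = d * ∫ x in s, f (g x) := by
  have hd : ∀ x, HasFDerivAt g (LinearMap.toContinuousLinearMap g.linear) x := by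
    intro x
    have h := ((LinearMap.toContinuousLinearMap g.linear).hasFDerivAt (x := x)).add_const (g 0)
    have h2 : (g : E3 → E3) = fun y => (LinearMap.toContinuousLinearMap g.linear) y + g 0 := by
      rw [AffineMap.decomp g]
      ext y
      simp
    rw [h2]
    exact h
  refine ⟨|(LinearMap.toContinuousLinearMap g.linear).det|, fun s hs f => ?_⟩
  rw [integral_image_eq_integral_abs_det_fderiv_smul volume hs
    (fun x _ => (hd x).hasFDerivWithinAt) hg.injOn]
  simp only [smul_eq_mul]
  rw [integral_const_mul]

/-- The tetrahedron in barycentric coordinates. -/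
def TT (b : AffineBasis (Fin 4) ℝ E3) : Set E3 := {x | ∀ i, 0 ≤ b.coord i x}

lemma TT_eq (b : AffineBasis (Fin 4) ℝ E3) : TT b = tetra b := by
  rw [tetra, b.convexHull_eq_nonneg_coord]; rfl

lemma TT_compact (b : AffineBasis (Fin 4) ℝ E3) : IsCompact (TT b) := by
  rw [TT_eq]
  exact (Set.finite_range b).isCompact_convexHull ℝ

lemma TT_pos (b : AffineBasis (Fin 4) ℝ E3) : 0 < (volume (TT b)).toReal := by
  apply ENNReal.toReal_pos _ (TT_compact b).measure_lt_top.ne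
  have h : (interior (TT b)).Nonempty := by
    rw [TT_eq, tetra]
    exact ⟨_, b.centroid_mem_interior_convexHull⟩
  exact (Measure.measure_pos_of_nonempty_interior _ h).ne'

lemma coord_cont (b : AffineBasis (Fin 4) ℝ E3) (i : Fin 4) : Continuous (b.coord i) :=
  AffineMap.continuous_of_finiteDimensional _

lemma ev_cont (b : AffineBasis (Fin 4) ℝ E3) (P : MvPolynomial (Fin 4) ℝ) :
    Continuous (fun x => eval (fun i => b.coord i x) P) := by
  have := MvPolynomial.continuous_eval P
  exact this.comp (continuous_pi (coord_cont b))

lemma ev_int (b : AffineBasis (Fin 4) ℝ E3) (P : MvPolynomial (Fin 4) ℝ) :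
    IntegrableOn (fun x => eval (fun i => b.coord i x) P) (TT b) :=
  (ev_cont b P).continuousOn.integrableOn_compact (TT_compact b)

/-- Integration over the tetrahedron of polynomials in barycentric coordinates. -/
def JJ (b : AffineBasis (Fin 4) ℝ E3) : MvPolynomial (Fin 4) ℝ →ₗ[ℝ] ℝ where
  toFun P := ∫ x in TT b, eval (fun i => b.coord i x) P
  map_add' P Q := by
    simp only [map_add]
    exact integral_add (ev_int b P) (ev_int b Q)
  map_smul' r P := by
    simp only [smul_eval, RingHom.id_apply, smul_eq_mul]
    exact integral_const_mul _ _

lemma JJ_apply (b : AffineBasis (Fin 4) ℝ E3) (P : MvPolynomial (Fin 4) ℝ) :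
    JJ b P = ∫ x in TT b, eval (fun i => b.coord i x) P := rfl

lemma JJ_congr (b : AffineBasis (Fin 4) ℝ E3) {P Q : MvPolynomial (Fin 4) ℝ}
    (h : ∀ w : Fin 4 → ℝ, w 0 + w 1 + w 2 + w 3 = 1 → eval w P = eval w Q) :
    JJ b P = JJ b Q := by
  rw [JJ_apply, JJ_apply]
  congr 1
  ext x
  apply h
  have := b.sum_coord_apply_eq_one x
  rw [Fin.sum_univ_four] at this
  exact this

lemma JJ_one (b : AffineBasis (Fin 4) ℝ E3) : 0 < JJ b 1 := by
  rw [JJ_apply]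
  simpa [Measure.real] using TT_pos b

lemma cov_sw (b : AffineBasis (Fin 4) ℝ E3) (i j : Fin 4) :
    ∃ g : E3 → E3, (∀ x, g (g x) = x) ∧
      (∀ x k, b.coord k (g x) = b.coord (Equiv.swap i j k) x) ∧
      ∀ s : Set E3, MeasurableSet s → ∀ f : E3 → ℝ,
        ∫ x in g '' s, f x = ∫ x in s, f (g x) := by
  let g := shr (b.coord i - b.coord j) (b j - b i)
  have hg : ∀ x k, b.coord k (g x) = b.coord (Equiv.swap i j k) x := by
    intro x k
    simp only [g, shr_apply, coord_shift]
    rcases eq_or_ne k i with rfl | h1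
    · by_cases h2 : k = j
      · subst h2; simp
      · simp [h2]
    · rcases eq_or_ne k j with rfl | h2
      · simp [h1]
      · simp [h1, h2, Equiv.swap_apply_of_ne_of_ne]
  have hinv : ∀ x, g (g x) = x := by
    intro x
    have e1 := hg x i
    have e2 := hg x j
    have : g (g x) = g x + (b.coord i (g x) - b.coord j (g x)) • (b j - b i) := by
      simp only [g, shr_apply, AffineMap.coe_sub, Pi.sub_apply]
    rw [this, e1, e2]
    simp only [g, shr_apply, AffineMap.coe_sub, Pi.sub_apply, Equiv.swap_apply_left,
      Equiv.swap_apply_right]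
    module
  obtain ⟨d, hd⟩ := cov g (Function.LeftInverse.injective hinv)
  have him : g '' TT b = TT b := by
    ext y
    constructor
    · rintro ⟨x, hx, rfl⟩ k
      rw [hg]; exact hx _
    · intro hy
      refine ⟨g y, fun k => ?_, hinv y⟩
      rw [hg]; exact hy _
  have h1 := hd (TT b) (TT_compact b).measurableSet (fun _ => 1)
  rw [him] at h1
  have hV : 0 < ∫ x in TT b, (1 : ℝ) := by
    simpa [Measure.real] using TT_pos b
  have hd1 : d = 1 := by
    have : (d - 1) * ∫ x in TT b, (1 : ℝ) = 0 := by linarith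
    rcases mul_eq_zero.1 this with h | h
    · linarith
    · exact absurd h hV.ne'
  refine ⟨g, hinv, hg, fun s hs f => ?_⟩
  rw [hd s hs f, hd1, one_mul]

lemma JJ_sw (b : AffineBasis (Fin 4) ℝ E3) (i j : Fin 4) (P : MvPolynomial (Fin 4) ℝ) :
    JJ b P = JJ b (rename (Equiv.swap i j) P) := by
  obtain ⟨g, hinv, hg, hc⟩ := cov_sw b i j
  have him : g '' TT b = TT b := by
    ext y
    constructor
    · rintro ⟨x, hx, rfl⟩ k
      rw [hg]; exact hx _
    · intro hy
      refine ⟨g y, fun k => ?_, hinv y⟩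
      rw [hg]; exact hy _
  have h := hc (TT b) (TT_compact b).measurableSet (fun x => eval (fun i => b.coord i x) P)
  rw [him] at h
  rw [JJ_apply, h, JJ_apply]
  congr 1
  ext x
  rw [eval_rename]
  congr 2
  ext k
  simp [hg]

/-- The substitution given by bisection of the edge `01`. -/
def bis : Fin 4 → MvPolynomial (Fin 4) ℝ :=
  ![X 0 + C (1/2) * X 1, C (1/2) * X 1, X 2, X 3]

lemma null01 (b : AffineBasis (Fin 4) ℝ E3) :
    volume {x : E3 | b.coord 0 x = b.coord 1 x} = 0 := by
  let S : AffineSubspace ℝ E3 :=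
    (AffineSubspace.mk' (0:ℝ) ⊥).comap (b.coord 0 - b.coord 1)
  have hS : (S : Set E3) = {x : E3 | b.coord 0 x = b.coord 1 x} := by
    ext x
    simp [S, sub_eq_zero]
  rw [← hS]
  apply Measure.addHaar_affineSubspace
  intro h
  have : b 0 ∈ (S : Set E3) := by rw [h]; trivial
  rw [hS] at this
  simp [AffineBasis.coord_apply] at this

lemma JJ_bis (b : AffineBasis (Fin 4) ℝ E3) (P : MvPolynomial (Fin 4) ℝ)
    (hP : rename (Equiv.swap 0 1) P = P) :
    JJ b P = JJ b (bind₁ bis P) := by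
  obtain ⟨s, sinv, hs, hc⟩ := cov_sw b 0 1
  set T1 : Set E3 := TT b ∩ {x | b.coord 1 x ≤ b.coord 0 x} with hT1
  set T2 : Set E3 := TT b ∩ {x | b.coord 0 x ≤ b.coord 1 x} with hT2
  have mT := (TT_compact b).measurableSet
  have m1 : MeasurableSet T1 :=
    mT.inter (isClosed_le (coord_cont b 1) (coord_cont b 0)).measurableSet
  have m2 : MeasurableSet T2 :=
    mT.inter (isClosed_le (coord_cont b 0) (coord_cont b 1)).measurableSet
  have hU : T1 ∪ T2 = TT b := by
    ext x
    constructor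
    · rintro (h | h) <;> exact h.1
    · intro h
      rcases le_total (b.coord 1 x) (b.coord 0 x) with h' | h'
      · exact Or.inl ⟨h, h'⟩
      · exact Or.inr ⟨h, h'⟩
  have hdisj : AEDisjoint volume T1 T2 := by
    refine measure_mono_null ?_ (null01 b)
    rintro x ⟨h1, h2⟩
    exact le_antisymm h2.2 h1.2
  have him : s '' T1 = T2 := by
    ext y
    constructor
    · rintro ⟨x, hx, rfl⟩
      refine ⟨fun k => ?_, ?_⟩
      · rw [hs]; exact hx.1 _
      · simp only [Set.mem_ofPred_eq, hs, Equiv.swap_apply_left, Equiv.swap_apply_right]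
        exact hx.2
    · intro hy
      refine ⟨s y, ⟨fun k => ?_, ?_⟩, sinv y⟩
      · rw [hs]; exact hy.1 _
      · simp only [Set.mem_ofPred_eq, hs, Equiv.swap_apply_left, Equiv.swap_apply_right]
        exact hy.2
  let g := shr ((1/2 : ℝ) • b.coord 1) (b 0 - b 1)
  let g' := shr (b.coord 1) (b 1 - b 0)
  have hg : ∀ x k, b.coord k (g x) = b.coord k x + (1/2 * b.coord 1 x) *
      ((if k = 0 then 1 else 0) - (if k = 1 then 1 else 0)) := by
    intro x k
    simp only [g, shr_apply, coord_shift, AffineMap.coe_smul, Pi.smul_apply, smul_eq_mul]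
  have hg' : ∀ x k, b.coord k (g' x) = b.coord k x + (b.coord 1 x) *
      ((if k = 1 then 1 else 0) - (if k = 0 then 1 else 0)) := by
    intro x k
    simp only [g', shr_apply, coord_shift]
  have gg' : ∀ x, g (g' x) = x := by
    intro x
    have : g (g' x) = g' x + (1/2 * b.coord 1 (g' x)) • (b 0 - b 1) := by
      simp only [g, shr_apply, AffineMap.coe_smul, Pi.smul_apply, smul_eq_mul]
    rw [this, hg']
    simp only [g', shr_apply]
    simp
    module
  have g'g : ∀ x, g' (g x) = x := by
    intro x
    have : g' (g x) = g x + (b.coord 1 (g x)) • (b 1 - b 0) := by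
      simp only [g', shr_apply]
    rw [this, hg]
    simp only [g, shr_apply, AffineMap.coe_smul, Pi.smul_apply, smul_eq_mul]
    simp
    module
  have himg : g '' TT b = T1 := by
    ext y
    constructor
    · rintro ⟨x, hx, rfl⟩
      have h0 := hx 0
      have h1 := hx 1
      have h2 := hx 2
      have h3 := hx 3
      refine ⟨fun k => ?_, ?_⟩
      · rw [hg]
        fin_cases k <;> simp <;> linarith
      · simp only [Set.mem_ofPred_eq, hg]
        simp
        linarith
    · rintro ⟨hy, hy'⟩
      refine ⟨g' y, fun k => ?_, gg' y⟩
      have h0 := hy 0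
      have h1 := hy 1
      have h2 := hy 2
      have h3 := hy 3
      simp only [Set.mem_ofPred_eq] at hy'
      rw [hg']
      fin_cases k <;> simp <;> linarith
  obtain ⟨d, hd⟩ := cov g (Function.LeftInverse.injective g'g)
  have key : ∀ Q : MvPolynomial (Fin 4) ℝ, rename (Equiv.swap 0 1) Q = Q →
      JJ b Q = 2 * d * JJ b (bind₁ bis Q) := by
    intro Q hQ
    have i1 := (ev_int b Q).mono_set (s := T1) Set.inter_subset_left
    have i2 := (ev_int b Q).mono_set (s := T2) Set.inter_subset_left
    have e1 : JJ b Q = (∫ x in T1, eval (fun i => b.coord i x) Q)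
        + ∫ x in T2, eval (fun i => b.coord i x) Q := by
      rw [JJ_apply, ← hU]
      exact setIntegral_union₀ hdisj m2.nullMeasurableSet i1 i2
    have e2 : ∫ x in T2, eval (fun i => b.coord i x) Q
        = ∫ x in T1, eval (fun i => b.coord i x) Q := by
      rw [← him, hc T1 m1]
      congr 1
      ext x
      conv_rhs => rw [← hQ, eval_rename]
      congr 2
      ext k
      simp [hs]
    have e3 : ∫ x in T1, eval (fun i => b.coord i x) Q = d * JJ b (bind₁ bis Q) := by
      rw [← himg, hd _ mT, JJ_apply]
      congr 2
      ext x
      rw [← MvPolynomial.coe_aeval_eq_eval, ← MvPolynomial.coe_aeval_eq_eval]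
      simp only [RingHom.coe_coe]
      rw [aeval_bind₁]
      congr 2
      ext k
      rw [hg]
      fin_cases k <;> simp [bis] <;> ring
    rw [e1, e2, e3]; ring
  have h1 := key 1 (by simp)
  rw [map_one (bind₁ bis)] at h1
  have hV := JJ_one b
  have h2d : 2 * d = 1 := by
    have : (2 * d - 1) * JJ b 1 = 0 := by linarith
    rcases mul_eq_zero.1 this with h | h
    · linarith
    · exact absurd h hV.ne'
  rw [key P hP, h2d, one_mul]

/-- The bubble function. -/
def bub : MvPolynomial (Fin 4) ℝ :=
  (∑ l, (9 * X l ^ 2 - 11 * X l ^ 3)) + 72 * ∑ l : Fin 4, ∑ m : Fin 4, ∑ n : Fin 4,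
                if l < m ∧ m < n then X l * X m * X n else 0

lemma bub_eq : bub = (9:ℝ) • (X 0 ^ 2) + (9:ℝ) • (X 1 ^ 2) + (9:ℝ) • (X 2 ^ 2) + (9:ℝ) • (X 3 ^ 2)
    - (11:ℝ) • (X 0 ^ 3) - (11:ℝ) • (X 1 ^ 3) - (11:ℝ) • (X 2 ^ 3) - (11:ℝ) • (X 3 ^ 3)
    + (72:ℝ) • (X 0 * X 1 * X 2) + (72:ℝ) • (X 0 * X 1 * X 3) + (72:ℝ) • (X 0 * X 2 * X 3)
    + (72:ℝ) • (X 1 * X 2 * X 3) := by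
  apply MvPolynomial.funext
  intro w
  simp [bub, Fin.sum_univ_four, smul_eval]
  ring

lemma JJ_bub (b : AffineBasis (Fin 4) ℝ E3) : JJ b bub = 19 / 5 * JJ b 1 := by
  have s2 : ∀ i, JJ b (X i ^ 2) = JJ b (X 0 ^ 2) := by
    intro i
    rw [JJ_sw b 0 i]; simp
  have s3 : ∀ i, JJ b (X i ^ 3) = JJ b (X 0 ^ 3) := by
    intro i
    rw [JJ_sw b 0 i]; simp
  have s1 : ∀ i, JJ b (X i) = JJ b (X 0) := by
    intro i
    rw [JJ_sw b 0 i]; simp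
  have t1 : JJ b (X 0 * X 1 * X 3) = JJ b (X 0 * X 1 * X 2) := by
    rw [JJ_sw b 2 3]; simp [Equiv.swap_apply_def]
  have t2 : JJ b (X 0 * X 2 * X 3) = JJ b (X 0 * X 1 * X 2) := by
    rw [← t1, JJ_sw b 1 2]; simp [Equiv.swap_apply_def]
  have t3 : JJ b (X 1 * X 2 * X 3) = JJ b (X 0 * X 1 * X 2) := by
    rw [← t2, JJ_sw b 0 1]; simp [Equiv.swap_apply_def]
  have u2 : JJ b (X 0 * X 2) = JJ b (X 0 * X 1) := by
    rw [JJ_sw b 1 2]; simp [Equiv.swap_apply_def]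
  have u3 : JJ b (X 0 * X 3) = JJ b (X 0 * X 1) := by
    rw [JJ_sw b 1 3]; simp [Equiv.swap_apply_def]
  have v2 : JJ b (X 0 ^ 2 * X 2) = JJ b (X 0 ^ 2 * X 1) := by
    rw [JJ_sw b 1 2]; simp [Equiv.swap_apply_def]
  have v3 : JJ b (X 0 ^ 2 * X 3) = JJ b (X 0 ^ 2 * X 1) := by
    rw [JJ_sw b 1 3]; simp [Equiv.swap_apply_def]
  have v4 : JJ b (X 1 ^ 2 * X 0) = JJ b (X 0 ^ 2 * X 1) := by
    rw [JJ_sw b 0 1]; simp [Equiv.swap_apply_def]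
  have v5 : JJ b (X 1 ^ 2 * X 2) = JJ b (X 0 ^ 2 * X 1) := by
    rw [← v2, JJ_sw b 0 1]; simp [Equiv.swap_apply_def]
  have p1 : JJ b 1 = JJ b (X 0 + X 1 + X 2 + X 3) :=
    JJ_congr b (fun w hw => by simp [hw])
  have p2 : JJ b (X 0) = JJ b (X 0 ^ 2 + X 0 * X 1 + X 0 * X 2 + X 0 * X 3) :=
    JJ_congr b (fun w hw => by simp; linear_combination (-w 0) * hw)
  have p3 : JJ b (X 0 ^ 2) = JJ b (X 0 ^ 3 + X 0 ^ 2 * X 1 + X 0 ^ 2 * X 2 + X 0 ^ 2 * X 3) :=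
    JJ_congr b (fun w hw => by simp; linear_combination (-w 0 ^ 2) * hw)
  have q1 : JJ b (X 0 * X 1) = JJ b ((1/2 : ℝ) • (X 0 * X 1) + (1/4 : ℝ) • (X 1 ^ 2)) := by
    rw [JJ_bis b _ (by simp [mul_comm])]
    exact JJ_congr b (fun w hw => by simp [bis, smul_eval]; ring)
  have q2 : JJ b (X 0 * X 1 * X 2)
      = JJ b ((1/2 : ℝ) • (X 0 * X 1 * X 2) + (1/4 : ℝ) • (X 1 ^ 2 * X 2)) := by
    rw [JJ_bis b _ (by simp [mul_comm, Equiv.swap_apply_def])]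
    exact JJ_congr b (fun w hw => by simp [bis, smul_eval]; ring)
  have q3 : JJ b (X 0 ^ 2 * X 1 + X 1 ^ 2 * X 0)
      = JJ b ((1/2 : ℝ) • (X 0 ^ 2 * X 1) + (3/4 : ℝ) • (X 1 ^ 2 * X 0)
        + (1/4 : ℝ) • (X 1 ^ 3)) := by
    rw [JJ_bis b _ (by simp [add_comm])]
    exact JJ_congr b (fun w hw => by simp [bis, smul_eval]; ring)
  rw [bub_eq]
  simp only [map_add, map_sub, map_smul, smul_eq_mul] at *
  rw [s2 1, s2 2, s2 3, s3 1, s3 2, s3 3, t1, t2, t3]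
  rw [s1 1, s1 2, s1 3] at p1
  rw [s2 1] at q1
  rw [s3 1] at q3
  linarith

lemma JJ_bub_X (b : AffineBasis (Fin 4) ℝ E3) (i : Fin 4) :
    JJ b (bub * X i) = 19 / 20 * JJ b 1 := by
  have hsym : ∀ i, JJ b (bub * X i) = JJ b (bub * X 0) := by
    intro i
    rw [JJ_sw b 0 i]
    apply JJ_congr
    intro w hw
    rw [bub_eq]
    fin_cases i <;> simp [smul_eval, Equiv.swap_apply_def, -mul_eq_mul_right_iff] <;> ring
  have p1 : JJ b bub = JJ b (bub * X 0 + bub * X 1 + bub * X 2 + bub * X 3) :=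
    JJ_congr b (fun w hw => by simp; linear_combination (-(eval w bub)) * hw)
  simp only [map_add] at p1
  rw [hsym 1, hsym 2, hsym 3, JJ_bub] at p1
  rw [hsym i]
  linarith

lemma quad_form_s17 (p : MvPolynomial (Fin 3) ℝ) (hp : p.totalDegree ≤ 2) :
    ∃ c : Fin 10 → ℝ, ∀ x : E3, evalP x p = c 0 + c 1 * x 0 + c 2 * x 1 + c 3 * x 2
      + c 4 * x 0 ^ 2 + c 5 * x 1 ^ 2 + c 6 * x 2 ^ 2 + c 7 * (x 0 * x 1) + c 8 * (x 0 * x 2)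
      + c 9 * (x 1 * x 2) := by
  have e : ∀ x : E3, evalP x p = ∑ m ∈ p.support, coeff m p * ∏ i, x i ^ m i := by
    intro x
    rw [evalP, eval_eq']
  have hm : ∀ m ∈ p.support, m 0 + m 1 + m 2 ≤ 2 := by
    intro m hm
    have := (le_totalDegree hm).trans hp
    rw [Finsupp.sum_fintype _ _ (by simp)] at this
    simpa [Fin.sum_univ_three] using this
  simp only [e]
  generalize p.support = S at hm
  induction S using Finset.induction_on with
  | empty => exact ⟨0, by simp⟩
  | insert m S hmS ih =>
    obtain ⟨c, hc⟩ := ih (fun m' h' => hm m' (Finset.mem_insert_of_mem h'))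
    have h := hm m (Finset.mem_insert_self _ _)
    have hmono : ∃ k : Fin 10, ∀ x : E3, ∏ i, x i ^ m i
        = (![1, x 0, x 1, x 2, x 0 ^ 2, x 1 ^ 2, x 2 ^ 2, x 0 * x 1, x 0 * x 2, x 1 * x 2] :
          Fin 10 → ℝ) k := by
      simp only [Fin.prod_univ_three]
      generalize m 0 = i at h
      generalize m 1 = j at h
      generalize m 2 = k at h
      have hi : i ≤ 2 := by omega
      have hj : j ≤ 2 := by omega
      have hk : k ≤ 2 := by omega
      interval_cases i <;> interval_cases j <;> interval_cases k <;> first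
        | omega
        | (refine ⟨0, fun x => ?_⟩; simp; done)
        | (refine ⟨1, fun x => ?_⟩; simp; done)
        | (refine ⟨2, fun x => ?_⟩; simp; done)
        | (refine ⟨3, fun x => ?_⟩; simp; done)
        | (refine ⟨4, fun x => ?_⟩; simp; done)
        | (refine ⟨5, fun x => ?_⟩; simp; done)
        | (refine ⟨6, fun x => ?_⟩; simp; done)
        | (refine ⟨7, fun x => ?_⟩; simp; done)
        | (refine ⟨8, fun x => ?_⟩; simp; done)
        | (refine ⟨9, fun x => ?_⟩; simp; done)
    obtain ⟨k, hk⟩ := hmono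
    refine ⟨fun n => c n + if n = k then coeff m p else 0, fun x => ?_⟩
    rw [Finset.sum_insert hmS, hc, hk]
    fin_cases k <;> simp <;> ring

lemma lin_form (p : MvPolynomial (Fin 3) ℝ) (hp : p.totalDegree ≤ 1) :
    ∃ c : Fin 4 → ℝ, ∀ x : E3, evalP x p = c 0 + c 1 * x 0 + c 2 * x 1 + c 3 * x 2 := by
  have e : ∀ x : E3, evalP x p = ∑ m ∈ p.support, coeff m p * ∏ i, x i ^ m i := by
    intro x
    rw [evalP, eval_eq']
  have hm : ∀ m ∈ p.support, m 0 + m 1 + m 2 ≤ 1 := by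
    intro m hm
    have := (le_totalDegree hm).trans hp
    rw [Finsupp.sum_fintype _ _ (by simp)] at this
    simpa [Fin.sum_univ_three] using this
  simp only [e]
  generalize p.support = S at hm
  induction S using Finset.induction_on with
  | empty => exact ⟨0, by simp⟩
  | insert m S hmS ih =>
    obtain ⟨c, hc⟩ := ih (fun m' h' => hm m' (Finset.mem_insert_of_mem h'))
    have h := hm m (Finset.mem_insert_self _ _)
    have hmono : ∃ k : Fin 4, ∀ x : E3, ∏ i, x i ^ m i
        = (![1, x 0, x 1, x 2] : Fin 4 → ℝ) k := by
      simp only [Fin.prod_univ_three]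
      generalize m 0 = i at h
      generalize m 1 = j at h
      generalize m 2 = k at h
      have hi : i ≤ 1 := by omega
      have hj : j ≤ 1 := by omega
      have hk : k ≤ 1 := by omega
      interval_cases i <;> interval_cases j <;> interval_cases k <;> first
        | omega
        | (refine ⟨0, fun x => ?_⟩; simp; done)
        | (refine ⟨1, fun x => ?_⟩; simp; done)
        | (refine ⟨2, fun x => ?_⟩; simp; done)
        | (refine ⟨3, fun x => ?_⟩; simp; done)
    obtain ⟨k, hk⟩ := hmono
    refine ⟨fun n => c n + if n = k then coeff m p else 0, fun x => ?_⟩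
    rw [Finset.sum_insert hmS, hc, hk]
    fin_cases k <;> simp <;> ring

/-- Directional derivative of the quadratic form with coefficients `c`. -/
def dq (c : Fin 10 → ℝ) (ζ x : E3) : ℝ :=
  (c 1 + 2 * c 4 * x 0 + c 7 * x 1 + c 8 * x 2) * ζ 0
  + (c 2 + 2 * c 5 * x 1 + c 7 * x 0 + c 9 * x 2) * ζ 1
  + (c 3 + 2 * c 6 * x 2 + c 8 * x 0 + c 9 * x 1) * ζ 2

lemma grad_form (p : MvPolynomial (Fin 3) ℝ) (c : Fin 10 → ℝ)
    (hc : ∀ x : E3, evalP x p = c 0 + c 1 * x 0 + c 2 * x 1 + c 3 * x 2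
      + c 4 * x 0 ^ 2 + c 5 * x 1 ^ 2 + c 6 * x 2 ^ 2 + c 7 * (x 0 * x 1) + c 8 * (x 0 * x 2)
      + c 9 * (x 1 * x 2)) (ζ x : E3) :
    ⟪ζ, gradient (fun y => evalP y p) x⟫ = dq c ζ x := by
  have hj : ∀ j : Fin 3, HasFDerivAt (fun y : E3 => y j) (EuclideanSpace.proj j : E3 →L[ℝ] ℝ) x :=
    fun j => (EuclideanSpace.proj j : E3 →L[ℝ] ℝ).hasFDerivAt
  have h0 := hj 0
  have h1 := hj 1
  have h2 := hj 2
  have H := (((((((((hasFDerivAt_const (c 0) x).add (h0.const_mul (c 1))).add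
    (h1.const_mul (c 2))).add (h2.const_mul (c 3))).add ((h0.pow 2).const_mul (c 4))).add
    ((h1.pow 2).const_mul (c 5))).add ((h2.pow 2).const_mul (c 6))).add
    ((h0.mul h1).const_mul (c 7))).add ((h0.mul h2).const_mul (c 8))).add
    ((h1.mul h2).const_mul (c 9))
  rw [real_inner_comm, gradient, InnerProductSpace.toDual_symm_apply]
  have hf : (fun y => evalP y p) = _ := funext hc
  rw [hf]
  erw [H.fderiv]
  simp [dq]
  ring

/-- if `q ∈ P₂(T)` satisfies `∫_T 𝔟₃ (ζ·∇q) dx = 0` for all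
`ζ ∈ ℝ³`, then the values of `q` at the midpoints of opposite edges coincide
(vertex indices `0,1,2,3`). -/
theorem stmt17 (a : Fin 4 → E3) (hind : AffineIndependent ℝ a)
    (lam : Fin 4 → MvPolynomial (Fin 3) ℝ)
    (hdeg : ∀ i, (lam i).totalDegree ≤ 1)
    (hval : ∀ i j, evalP (a j) (lam i) = if i = j then 1 else 0)
    (p : MvPolynomial (Fin 3) ℝ) (hp : p.totalDegree ≤ 2)
    (hb : ∀ ζ : E3,
      ∫ x in tetra a,
        evalP x ((∑ l, (9 * lam l ^ 2 - 11 * lam l ^ 3))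
            + 72 * ∑ l : Fin 4, ∑ m : Fin 4, ∑ n : Fin 4,
                if l < m ∧ m < n then lam l * lam m * lam n else 0)
          * ⟪ζ, gradient (fun y => evalP y p) x⟫ = 0) :
    evalP (midpoint ℝ (a 0) (a 1)) p = evalP (midpoint ℝ (a 2) (a 3)) p ∧
    evalP (midpoint ℝ (a 0) (a 2)) p = evalP (midpoint ℝ (a 1) (a 3)) p ∧
    evalP (midpoint ℝ (a 0) (a 3)) p = evalP (midpoint ℝ (a 1) (a 2)) p := by
  have htop : affineSpan ℝ (Set.range a) = ⊤ := by
    rw [hind.affineSpan_eq_top_iff_card_eq_finrank_add_one]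
    simp
  let b : AffineBasis (Fin 4) ℝ E3 := ⟨a, hind, htop⟩
  have hba : ∀ i, b i = a i := fun _ => rfl
  have hT : tetra a = TT b := (TT_eq b).symm
  have hsum : ∀ x, b.coord 0 x + b.coord 1 x + b.coord 2 x + b.coord 3 x = 1 := by
    intro x
    have := b.sum_coord_apply_eq_one x
    rw [Fin.sum_univ_four] at this
    exact this
  have hx : ∀ (x : E3) (k : Fin 3), x k = b.coord 0 x * a 0 k + b.coord 1 x * a 1 k
      + b.coord 2 x * a 2 k + b.coord 3 x * a 3 k := by
    intro x k
    have := b.linear_combination_coord_eq_self x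
    rw [Fin.sum_univ_four] at this
    have h2 := congrArg (fun y : E3 => y k) this
    simp only [hba, PiLp.add_apply, PiLp.smul_apply, smul_eq_mul] at h2
    exact h2.symm
  have hlam : ∀ i x, evalP x (lam i) = b.coord i x := by
    intro i x
    obtain ⟨c, hc⟩ := lin_form (lam i) (hdeg i)
    have e : evalP x (lam i) = b.coord 0 x * evalP (a 0) (lam i)
        + b.coord 1 x * evalP (a 1) (lam i) + b.coord 2 x * evalP (a 2) (lam i)
        + b.coord 3 x * evalP (a 3) (lam i) := by
      simp only [hc]
      rw [hx x 0, hx x 1, hx x 2]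
      linear_combination (-c 0) * hsum x
    rw [e]
    simp only [hval]
    fin_cases i <;> simp
  obtain ⟨c, hc⟩ := quad_form_s17 p hp
  have hB : ∀ x, evalP x ((∑ l, (9 * lam l ^ 2 - 11 * lam l ^ 3))
            + 72 * ∑ l : Fin 4, ∑ m : Fin 4, ∑ n : Fin 4,
                if l < m ∧ m < n then lam l * lam m * lam n else 0)
        = eval (fun i => b.coord i x) bub := by
    intro x
    have h : ∀ i, eval (fun j => x j) (lam i) = b.coord i x := fun i => hlam i x
    rw [bub_eq]
    simp [evalP, Fin.sum_univ_four, smul_eval, h]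
    ring
  have hD : ∀ ζ : E3, dq c ζ (a 0) + dq c ζ (a 1) + dq c ζ (a 2) + dq c ζ (a 3) = 0 := by
    intro ζ
    have h := hb ζ
    have e : JJ b (dq c ζ (a 0) • (bub * X 0) + dq c ζ (a 1) • (bub * X 1)
        + dq c ζ (a 2) • (bub * X 2) + dq c ζ (a 3) • (bub * X 3)) = 0 := by
      rw [← h, hT, JJ_apply]
      congr 1
      ext x
      rw [hB, grad_form p c hc]
      have e2 : dq c ζ x = b.coord 0 x * dq c ζ (a 0) + b.coord 1 x * dq c ζ (a 1)
          + b.coord 2 x * dq c ζ (a 2) + b.coord 3 x * dq c ζ (a 3) := by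
        simp only [dq]
        rw [hx x 0, hx x 1, hx x 2]
        linear_combination (-(c 1 * ζ 0 + c 2 * ζ 1 + c 3 * ζ 2)) * hsum x
      rw [e2]
      simp only [map_add, smul_eval, map_mul, eval_X]
      ring
    simp only [map_add, map_smul, smul_eq_mul, JJ_bub_X] at e
    have hV := JJ_one b
    have : (dq c ζ (a 0) + dq c ζ (a 1) + dq c ζ (a 2) + dq c ζ (a 3)) * JJ b 1 = 0 := by
      linarith
    exact (mul_eq_zero.1 this).resolve_right hV.ne'
  have hmid : ∀ (i j : Fin 4) (k : Fin 3), (midpoint ℝ (a i) (a j)) k = (a i k + a j k) / 2 := by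
    intro i j k
    rw [midpoint_eq_smul_add]
    simp
    ring
  refine ⟨?_, ?_, ?_⟩
  · have h := hD (a 0 + a 1 - a 2 - a 3)
    simp only [dq, PiLp.add_apply, PiLp.sub_apply] at h
    simp only [hc, hmid]
    linear_combination (1/8) * h
  · have h := hD (a 0 + a 2 - a 1 - a 3)
    simp only [dq, PiLp.add_apply, PiLp.sub_apply] at h
    simp only [hc, hmid]
    linear_combination (1/8) * h
  · have h := hD (a 0 + a 3 - a 1 - a 2)
    simp only [dq, PiLp.add_apply, PiLp.sub_apply] at h
    simp only [hc, hmid]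
    linear_combination (1/8) * h
end
end

section
/- Let T be a nondegenerate tetrahedron and 𝔒₃(T) = span{λᵢ²λⱼ, λᵢλⱼ² : 1 ≤ i < j ≤ 4}. If v ∈ 𝔒₃(T) satisfies ∫_{Fᵢ} v λⱼ ds = 0 for all i ≠ j in {1,2,3,4}, then v = 0. In particular 𝔒₃(T) ∩ 𝔅₃(T) = {0}. -/
open MeasureTheory MvPolynomial
open scoped RealInnerProductSpace

noncomputable section

/-- Polynomials of degree at most one are affine. -/
lemma evalP_affine (p : MvPolynomial (Fin 3) ℝ) (hp : p.totalDegree ≤ 1) (u v w : E3)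
    (x y z : ℝ) (h : x + y + z = 1) :
    evalP (x • u + y • v + z • w) p = x * evalP u p + y * evalP v p + z * evalP w p := by
  unfold evalP
  simp only [MvPolynomial.eval_eq', Finset.mul_sum, ← Finset.sum_add_distrib]
  refine Finset.sum_congr rfl fun d hd => ?_
  have h1 := (MvPolynomial.le_totalDegree hd).trans hp
  rw [Finsupp.sum_fintype _ _ (by simp)] at h1
  simp only [Fin.sum_univ_three] at h1
  simp only [Fin.prod_univ_three, PiLp.add_apply, PiLp.smul_apply, smul_eq_mul]
  have h2 : (d 0 = 0 ∧ d 1 = 0 ∧ d 2 = 0) ∨ (d 0 = 1 ∧ d 1 = 0 ∧ d 2 = 0) ∨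
    (d 0 = 0 ∧ d 1 = 1 ∧ d 2 = 0) ∨ (d 0 = 0 ∧ d 1 = 0 ∧ d 2 = 1) := by omega
  rcases h2 with ⟨e0, e1, e2⟩ | ⟨e0, e1, e2⟩ | ⟨e0, e1, e2⟩ | ⟨e0, e1, e2⟩ <;>
    simp only [e0, e1, e2, pow_zero, pow_one, mul_one, one_mul]
  · linear_combination -(coeff d p) * h
  all_goals ring

/-- The reference triangle. -/
def refTri : Set (ℝ × ℝ) := {x | 0 ≤ x.1 ∧ 0 ≤ x.2 ∧ x.1 + x.2 ≤ 1}

lemma refTri_closed : IsClosed refTri := by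
  have h1 : IsClosed {x : ℝ × ℝ | 0 ≤ x.1} := isClosed_le (by fun_prop) (by fun_prop)
  have h2 : IsClosed {x : ℝ × ℝ | 0 ≤ x.2} := isClosed_le (by fun_prop) (by fun_prop)
  have h3 : IsClosed {x : ℝ × ℝ | x.1 + x.2 ≤ 1} := isClosed_le (by fun_prop) (by fun_prop)
  exact h1.inter (h2.inter h3)

lemma refTri_compact : IsCompact refTri := by
  have h : IsCompact (Set.Icc (0 : ℝ) 1 ×ˢ Set.Icc (0 : ℝ) 1) := isCompact_Icc.prod isCompact_Icc
  refine h.of_isClosed_subset refTri_closed ?_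
  rintro ⟨x, y⟩ ⟨h1, h2, h3⟩
  simp only at h1 h2 h3
  exact ⟨⟨h1, by dsimp; linarith⟩, ⟨h2, by dsimp; linarith⟩⟩

lemma integral_refTri (F : ℝ × ℝ → ℝ) (hF : Continuous F) :
    ∫ x in refTri, F x = ∫ x in (0 : ℝ)..1, ∫ y in (0 : ℝ)..(1 - x), F (x, y) := by
  have hm := refTri_closed.measurableSet
  rw [← integral_indicator hm]
  have hFint : Integrable (refTri.indicator F) (volume : Measure (ℝ × ℝ)) :=
    (hF.continuousOn.integrableOn_compact refTri_compact).integrable_indicator hm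
  rw [Measure.volume_eq_prod] at hFint ⊢
  rw [integral_prod _ hFint, intervalIntegral.integral_of_le zero_le_one,
    ← integral_Icc_eq_integral_Ioc, ← integral_indicator measurableSet_Icc]
  congr 1
  ext x
  by_cases hx : x ∈ Set.Icc (0 : ℝ) 1
  · rw [Set.indicator_of_mem hx, intervalIntegral.integral_of_le (by linarith [hx.2]),
      ← integral_Icc_eq_integral_Ioc, ← integral_indicator measurableSet_Icc]
    congr 1
    ext y
    have : (x, y) ∈ refTri ↔ y ∈ Set.Icc 0 (1 - x) := by
      simp only [refTri, Set.mem_ofPred_eq, Set.mem_Icc]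
      constructor
      · rintro ⟨_, h2, h3⟩
        exact ⟨h2, by linarith⟩
      · rintro ⟨h2, h3⟩
        exact ⟨hx.1, h2, by linarith⟩
    by_cases h : (x, y) ∈ refTri
    · rw [Set.indicator_of_mem h, Set.indicator_of_mem (this.1 h)]
    · rw [Set.indicator_of_notMem h, Set.indicator_of_notMem (fun h' => h (this.2 h'))]
  · rw [Set.indicator_of_notMem hx]
    have : ∀ y, refTri.indicator F (x, y) = 0 := by
      intro y
      apply Set.indicator_of_notMem
      rintro ⟨h1, h2, h3⟩
      simp only at h1 h2 h3
      exact hx ⟨h1, by linarith⟩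
    simp [this]

lemma integral_quartic (A B C D E G : ℝ) :
    ∫ x in refTri, (A * (x.1 ^ 2 * x.2) + B * (x.1 ^ 2 * (1 - x.1 - x.2)) + C * (x.2 ^ 2 * x.1)
      + D * ((1 - x.1 - x.2) ^ 2 * x.1) + E * (x.2 ^ 2 * (1 - x.1 - x.2))
      + G * ((1 - x.1 - x.2) ^ 2 * x.2)) * x.1
    = (6 * (A + B) + 4 * (C + D) + 2 * (E + G)) / 720 := by
  rw [integral_refTri _ (by fun_prop)]
  have inner : ∀ x : ℝ, (∫ y in (0 : ℝ)..(1 - x),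
      (A * (x ^ 2 * y) + B * (x ^ 2 * (1 - x - y)) + C * (y ^ 2 * x)
      + D * ((1 - x - y) ^ 2 * x) + E * (y ^ 2 * (1 - x - y))
      + G * ((1 - x - y) ^ 2 * y)) * x)
      = (A + B) * x ^ 3 * (1 - x) ^ 2 / 2 + (C + D) * x ^ 2 * (1 - x) ^ 3 / 3
        + (E + G) * x * (1 - x) ^ 4 / 12 := by
    intro x
    rw [intervalIntegral.integral_eq_sub_of_hasDerivAt
      (f := fun y => (A * (x ^ 2 * (y ^ 2 / 2)) + B * (x ^ 2 * ((1 - x) * y - y ^ 2 / 2))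
        + C * (y ^ 3 / 3 * x) + D * (((1 - x) ^ 2 * y - (1 - x) * y ^ 2 + y ^ 3 / 3) * x)
        + E * (y ^ 3 / 3 * (1 - x) - y ^ 4 / 4)
        + G * ((1 - x) ^ 2 * (y ^ 2 / 2) - 2 * (1 - x) * (y ^ 3 / 3) + y ^ 4 / 4)) * x)]
    · ring
    · intro y _
      have d1 := hasDerivAt_id' y
      have d2 := hasDerivAt_pow 2 y
      have d3 := hasDerivAt_pow 3 y
      have d4 := hasDerivAt_pow 4 y
      refine HasDerivAt.congr_deriv (f' := _) (((((((((d2.div_const 2).const_mul (x ^ 2)).const_mul A).add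
        ((((d1.const_mul (1 - x)).sub (d2.div_const 2)).const_mul (x ^ 2)).const_mul B)).add
        (((d3.div_const 3).mul_const x).const_mul C)).add
        (((((d1.const_mul ((1 - x) ^ 2)).sub (d2.const_mul (1 - x))).add
          (d3.div_const 3)).mul_const x).const_mul D)).add
        ((((d3.div_const 3).mul_const (1 - x)).sub (d4.div_const 4)).const_mul E)).add
        (((((d2.div_const 2).const_mul ((1 - x) ^ 2)).sub
          ((d3.div_const 3).const_mul (2 * (1 - x)))).add
          (d4.div_const 4)).const_mul G)).mul_const x) ?_
      push_cast
      ring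
    · exact Continuous.intervalIntegrable (by fun_prop) _ _
  simp only [inner]
  rw [intervalIntegral.integral_eq_sub_of_hasDerivAt
      (f := fun x => (A + B) / 2 * (x ^ 4 / 4 - 2 * (x ^ 5 / 5) + x ^ 6 / 6)
        + (C + D) / 3 * (x ^ 3 / 3 - 3 * (x ^ 4 / 4) + 3 * (x ^ 5 / 5) - x ^ 6 / 6)
        + (E + G) / 12 * (x ^ 2 / 2 - 4 * (x ^ 3 / 3) + 6 * (x ^ 4 / 4) - 4 * (x ^ 5 / 5)
          + x ^ 6 / 6))]
  · norm_num
    ring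
  · intro y _
    have d2 := (hasDerivAt_pow 2 y).div_const 2
    have d3 := (hasDerivAt_pow 3 y).div_const 3
    have d4 := (hasDerivAt_pow 4 y).div_const 4
    have d5 := (hasDerivAt_pow 5 y).div_const 5
    have d6 := (hasDerivAt_pow 6 y).div_const 6
    refine HasDerivAt.congr_deriv (f' := _) (((((d4.sub (d5.const_mul 2)).add d6).const_mul ((A + B) / 2)).add
      ((((d3.sub (d4.const_mul 3)).add (d5.const_mul 3)).sub d6).const_mul ((C + D) / 3))).add
      (((((d2.sub (d3.const_mul 4)).add (d4.const_mul 6)).sub (d5.const_mul 4)).add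
        d6).const_mul ((E + G) / 12))) ?_
    norm_num
    ring
  · exact Continuous.intervalIntegrable (by fun_prop) _ _

/-- Hausdorff measure on a plane is a nonzero multiple of the parameter area. -/
lemma integral_plane (L : ℝ × ℝ →ₗ[ℝ] E3) (hL : Function.Injective L) (b : E3) :
    ∃ c : ℝ, c ≠ 0 ∧ ∀ (S : Set (ℝ × ℝ)) (g : E3 → ℝ),
      ∫ x in (fun t => b + L t) '' S, g x ∂(μH[2]) = c * ∫ t in S, g (b + L t) := by
  set f : ℝ × ℝ → E3 := fun t => b + L t with hf
  have hLc : Continuous L := L.continuous_of_finiteDimensional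
  obtain ⟨K, hK0, hK⟩ := L.exists_antilipschitzWith (LinearMap.ker_eq_bot.2 hL)
  have hK' : AntilipschitzWith K f := by
    intro x y
    have := hK x y
    simpa [hf, edist_add_left] using this
  have hlip : LipschitzWith ‖L.toContinuousLinearMap‖₊ f := by
    intro x y
    have := L.toContinuousLinearMap.lipschitz x y
    simpa [hf, edist_add_left] using this
  have hemb : MeasurableEmbedding f :=
    (hK'.isClosedEmbedding hlip.uniformContinuous).measurableEmbedding
  set ν : Measure (ℝ × ℝ) := (μH[2] : Measure E3).comap f with hν
  have hνa : ∀ s, ν s = μH[2] (f '' s) := fun s => hemb.comap_apply _ s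
  have : IsFiniteMeasureOnCompacts ν := by
    constructor
    intro s hs
    rw [hνa]
    refine (hlip.hausdorffMeasure_image_le (by norm_num) s).trans_lt ?_
    rw [hausdorffMeasure_prod_real]
    exact ENNReal.mul_lt_top (ENNReal.rpow_lt_top_of_nonneg (by norm_num) (by simp))
      hs.measure_lt_top
  have : ν.IsAddLeftInvariant := by
    constructor
    intro t
    ext s hs
    rw [Measure.map_apply (measurable_const_add t) hs, hνa, hνa,
      ← measure_preimage_add (μH[2] : Measure E3) (L t) (f '' s)]
    congr 1
    ext y
    simp only [Set.mem_image, Set.mem_preimage]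
    constructor
    · rintro ⟨x, hx, rfl⟩
      exact ⟨t + x, hx, by simp only [hf, map_add]; abel⟩
    · rintro ⟨x, hx, hxy⟩
      refine ⟨x - t, by simpa using hx, ?_⟩
      simp only [hf, map_sub] at hxy ⊢
      rw [← add_sub_assoc, hxy]; abel
  have key := Measure.isAddLeftInvariant_eq_smul ν volume
  set c := Measure.addHaarScalarFactor ν volume
  refine ⟨(c : ℝ), ?_, ?_⟩
  · intro hc
    have hc' : c = 0 := by exact_mod_cast hc
    rw [hc', zero_smul] at key
    have h1 := hK'.le_hausdorffMeasure_image (d := 2) (by norm_num) Set.univ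
    rw [← hνa, key, hausdorffMeasure_prod_real] at h1
    simp at h1
  · intro S g
    have h1 : (μH[2] : Measure E3).restrict (f '' S) = (ν.map f).restrict (f '' S) := by
      rw [hν, hemb.map_comap, Measure.restrict_restrict_of_subset (Set.image_subset_range _ _)]
    rw [h1, hemb.setIntegral_map, Set.preimage_image_eq _ hemb.injective, key,
      Measure.restrict_smul, integral_smul_nnreal_measure]
    rfl

lemma face_eq (a : Fin 4 → E3) (i j p q : Fin 4) (hij : i ≠ j) (hip : i ≠ p) (hiq : i ≠ q)
    (hjp : j ≠ p) (hjq : j ≠ q) (hpq : p ≠ q) :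
    face a i = (fun t : ℝ × ℝ => t.1 • a j + t.2 • a p + (1 - t.1 - t.2) • a q) '' refTri := by
  have hset : {k | k ≠ i} = ({j, p, q} : Set (Fin 4)) := by
    ext k
    simp only [Set.mem_ofPred_eq, Set.mem_insert_iff, Set.mem_singleton_iff]
    omega
  unfold face
  rw [hset]
  apply Set.Subset.antisymm
  · apply convexHull_min
    · rintro _ ⟨k, hk, rfl⟩
      rcases hk with rfl | rfl | rfl
      · exact ⟨(1, 0), by simp [refTri], by simp⟩
      · exact ⟨(0, 1), by simp [refTri], by simp⟩
      · exact ⟨(0, 0), by simp [refTri], by simp⟩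
    · rintro _ ⟨s, ⟨s1, s2, s3⟩, rfl⟩ _ ⟨t, ⟨t1, t2, t3⟩, rfl⟩ α β hα hβ hαβ
      refine ⟨α • s + β • t, ⟨?_, ?_, ?_⟩, ?_⟩
      · simp only [Prod.fst_add, Prod.smul_fst, smul_eq_mul]; positivity
      · simp only [Prod.snd_add, Prod.smul_snd, smul_eq_mul]; positivity
      · simp only [Prod.fst_add, Prod.smul_fst, Prod.snd_add, Prod.smul_snd, smul_eq_mul]
        nlinarith [mul_le_mul_of_nonneg_left s3 hα, mul_le_mul_of_nonneg_left t3 hβ]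
      · obtain rfl : β = 1 - α := by linarith
        simp only [Prod.fst_add, Prod.smul_fst, Prod.snd_add, Prod.smul_snd, smul_eq_mul]
        module
  · rintro _ ⟨t, ⟨t1, t2, t3⟩, rfl⟩
    have hc := convex_convexHull ℝ (a '' {j, p, q})
    have mem : ∀ k ∈ ({j, p, q} : Set (Fin 4)), a k ∈ convexHull ℝ (a '' {j, p, q}) :=
      fun k hk => subset_convexHull _ _ ⟨k, hk, rfl⟩
    have := hc.sum_mem (t := Finset.univ) (w := ![t.1, t.2, 1 - t.1 - t.2])
      (z := ![a j, a p, a q])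
      (by intro k _; fin_cases k <;> simp <;> linarith)
      (by simp [Fin.sum_univ_three])
      (by intro k _; fin_cases k <;> simp <;> apply mem <;> simp)
    simpa [Fin.sum_univ_three] using this

/-- Sum over pairs of distinct indices, with one index `i` dropped. -/
lemma sum_pairs (c : Fin 4 → Fin 4 → ℝ) (m : Fin 4 → ℝ) (i j p q : Fin 4) (hij : i ≠ j)
    (hip : i ≠ p) (hiq : i ≠ q) (hjp : j ≠ p) (hjq : j ≠ q) (hpq : p ≠ q) (hm : m i = 0) :
    (∑ k, ∑ l, if k = l then 0 else c k l * (m k ^ 2 * m l)) =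
      c j p * (m j ^ 2 * m p) + c j q * (m j ^ 2 * m q) + c p j * (m p ^ 2 * m j)
      + c q j * (m q ^ 2 * m j) + c p q * (m p ^ 2 * m q) + c q p * (m q ^ 2 * m p) := by
  have hu : (Finset.univ : Finset (Fin 4)) = {i, j, p, q} := by
    ext k
    simp only [Finset.mem_univ, Finset.mem_insert, Finset.mem_singleton, true_iff]
    omega
  have h4 : ∀ g : Fin 4 → ℝ, ∑ k, g k = g i + g j + g p + g q := by
    intro g
    rw [hu, Finset.sum_insert (by simp [*]), Finset.sum_insert (by simp [*]),
      Finset.sum_insert (by simp [*]), Finset.sum_singleton]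
    ring
  simp only [h4, hm, hij, hip, hiq, hjp, hjq, hpq, hij.symm, hip.symm, hiq.symm, hjp.symm,
    hjq.symm, hpq.symm, if_true, if_false]
  ring

lemma span_form (lam : Fin 4 → MvPolynomial (Fin 3) ℝ) (v : MvPolynomial (Fin 3) ℝ)
    (hv : v ∈ Submodule.span ℝ {w : MvPolynomial (Fin 3) ℝ |
        ∃ i j : Fin 4, i ≠ j ∧ w = lam i ^ 2 * lam j}) :
    ∃ c : Fin 4 → Fin 4 → ℝ,
      v = ∑ k, ∑ l, if k = l then 0 else C (c k l) * (lam k ^ 2 * lam l) := by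
  induction hv using Submodule.span_induction with
  | mem x h =>
    obtain ⟨i, j, hij, rfl⟩ := h
    refine ⟨fun k l => if k = i ∧ l = j then 1 else 0, ?_⟩
    rw [Finset.sum_eq_single i, Finset.sum_eq_single j]
    · simp [hij]
    · intro l _ hl
      simp [hl]
    · simp
    · intro k _ hk
      simp [hk]
    · simp
  | zero => exact ⟨0, by simp⟩
  | add x y _ _ hx hy =>
    obtain ⟨c, rfl⟩ := hx
    obtain ⟨d, rfl⟩ := hy
    refine ⟨c + d, ?_⟩
    simp only [← Finset.sum_add_distrib]
    refine Finset.sum_congr rfl fun k _ => Finset.sum_congr rfl fun l _ => ?_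
    split_ifs
    · simp
    · simp only [Pi.add_apply, map_add]; ring
  | smul r x _ hx =>
    obtain ⟨c, rfl⟩ := hx
    refine ⟨r • c, ?_⟩
    simp only [Finset.smul_sum]
    refine Finset.sum_congr rfl fun k _ => Finset.sum_congr rfl fun l _ => ?_
    split_ifs
    · simp
    · simp only [Pi.smul_apply, smul_eq_mul, map_mul, MvPolynomial.smul_eq_C_mul]; ring

lemma moment_eq (a : Fin 4 → E3) (lam : Fin 4 → MvPolynomial (Fin 3) ℝ)
    (hdeg : ∀ i, (lam i).totalDegree ≤ 1)
    (hval : ∀ i j, evalP (a j) (lam i) = if i = j then 1 else 0)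
    (c : Fin 4 → Fin 4 → ℝ) (v : MvPolynomial (Fin 3) ℝ)
    (hv : v = ∑ k, ∑ l, if k = l then 0 else C (c k l) * (lam k ^ 2 * lam l))
    (i j p q : Fin 4) (hij : i ≠ j)
    (hip : i ≠ p) (hiq : i ≠ q) (hjp : j ≠ p) (hjq : j ≠ q) (hpq : p ≠ q)
    (h : ∫ x in face a i, evalP x v * evalP x (lam j) ∂(μH[2]) = 0) :
    6 * (c j p + c j q) + 4 * (c p j + c q j) + 2 * (c p q + c q p) = 0 := by
  set L : ℝ × ℝ →ₗ[ℝ] E3 := (LinearMap.fst ℝ ℝ ℝ).smulRight (a j - a q) +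
    (LinearMap.snd ℝ ℝ ℝ).smulRight (a p - a q) with hLdef
  have hfL : ∀ t : ℝ × ℝ, a q + L t = t.1 • a j + t.2 • a p + (1 - t.1 - t.2) • a q := by
    intro t
    simp only [hLdef, LinearMap.add_apply, LinearMap.smulRight_apply, LinearMap.fst_apply,
      LinearMap.snd_apply]
    module
  have hl : ∀ (k : Fin 4) (t : ℝ × ℝ), evalP (a q + L t) (lam k) =
      t.1 * (if k = j then 1 else 0) + t.2 * (if k = p then 1 else 0)
        + (1 - t.1 - t.2) * (if k = q then 1 else 0) := by
    intro k t
    rw [hfL, evalP_affine _ (hdeg k) _ _ _ _ _ _ (by ring), hval, hval, hval]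
  have li : ∀ t, evalP (a q + L t) (lam i) = 0 := fun t => by
    rw [hl]; simp [hij, hip, hiq]
  have lj : ∀ t, evalP (a q + L t) (lam j) = t.1 := fun t => by
    rw [hl]; simp [hjp, hjq]
  have lp : ∀ t, evalP (a q + L t) (lam p) = t.2 := fun t => by
    rw [hl]; simp [hjp.symm, hpq]
  have lq : ∀ t, evalP (a q + L t) (lam q) = 1 - t.1 - t.2 := fun t => by
    rw [hl]; simp [hjq.symm, hpq.symm]
  have hinj : Function.Injective L := by
    intro s t hst
    ext
    · rw [← lj s, hst, lj t]
    · rw [← lp s, hst, lp t]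
  obtain ⟨κ, hκ, hI⟩ := integral_plane L hinj (a q)
  have hvv : ∀ t, evalP (a q + L t) v = c j p * (t.1 ^ 2 * t.2)
      + c j q * (t.1 ^ 2 * (1 - t.1 - t.2)) + c p j * (t.2 ^ 2 * t.1)
      + c q j * ((1 - t.1 - t.2) ^ 2 * t.1) + c p q * (t.2 ^ 2 * (1 - t.1 - t.2))
      + c q p * ((1 - t.1 - t.2) ^ 2 * t.2) := by
    intro t
    have h0 : evalP (a q + L t) v = ∑ k, ∑ l, if k = l then 0 else
        c k l * (evalP (a q + L t) (lam k) ^ 2 * evalP (a q + L t) (lam l)) := by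
      rw [hv]
      unfold evalP
      simp only [map_sum]
      refine Finset.sum_congr rfl fun k _ => Finset.sum_congr rfl fun l _ => ?_
      split_ifs <;> simp
    rw [h0, sum_pairs c (fun k => evalP (a q + L t) (lam k)) i j p q hij hip hiq hjp hjq hpq
      (li t)]
    simp only [lj, lp, lq]
  rw [face_eq a i j p q hij hip hiq hjp hjq hpq] at h
  simp only [← hfL] at h
  rw [hI] at h
  simp only [hvv, lj] at h
  rw [integral_quartic] at h
  have := (mul_eq_zero.1 h).resolve_left hκ
  linarith

lemma main_aux (a : Fin 4 → E3)
    (lam : Fin 4 → MvPolynomial (Fin 3) ℝ)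
    (hdeg : ∀ i, (lam i).totalDegree ≤ 1)
    (hval : ∀ i j, evalP (a j) (lam i) = if i = j then 1 else 0)
    (v : MvPolynomial (Fin 3) ℝ) (hv : v ∈ Submodule.span ℝ {w : MvPolynomial (Fin 3) ℝ |
        ∃ i j : Fin 4, i ≠ j ∧ w = lam i ^ 2 * lam j})
    (h : ∀ i j : Fin 4, i ≠ j →
        ∫ x in face a i, evalP x v * evalP x (lam j) ∂(μH[2]) = 0) : v = 0 := by
  obtain ⟨c, hc⟩ := span_form lam v hv
  have M := fun i j p q hij hip hiq hjp hjq hpq =>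
    moment_eq a lam hdeg hval c v hc i j p q hij hip hiq hjp hjq hpq (h i j hij)
  have e01 := M 0 1 2 3 (by decide) (by decide) (by decide) (by decide) (by decide) (by decide)
  have e02 := M 0 2 1 3 (by decide) (by decide) (by decide) (by decide) (by decide) (by decide)
  have e03 := M 0 3 1 2 (by decide) (by decide) (by decide) (by decide) (by decide) (by decide)
  have e10 := M 1 0 2 3 (by decide) (by decide) (by decide) (by decide) (by decide) (by decide)
  have e12 := M 1 2 0 3 (by decide) (by decide) (by decide) (by decide) (by decide) (by decide)
  have e13 := M 1 3 0 2 (by decide) (by decide) (by decide) (by decide) (by decide) (by decide)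
  have e20 := M 2 0 1 3 (by decide) (by decide) (by decide) (by decide) (by decide) (by decide)
  have e21 := M 2 1 0 3 (by decide) (by decide) (by decide) (by decide) (by decide) (by decide)
  have e23 := M 2 3 0 1 (by decide) (by decide) (by decide) (by decide) (by decide) (by decide)
  have e30 := M 3 0 1 2 (by decide) (by decide) (by decide) (by decide) (by decide) (by decide)
  have e31 := M 3 1 0 2 (by decide) (by decide) (by decide) (by decide) (by decide) (by decide)
  have e32 := M 3 2 0 1 (by decide) (by decide) (by decide) (by decide) (by decide) (by decide)
  clear M h
  have hz : ∀ k l : Fin 4, k ≠ l → c k l = 0 := by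
    intro k l hkl
    fin_cases k <;> fin_cases l <;> first | exact absurd rfl hkl | (simp only [Fin.zero_eta, Fin.mk_one, Fin.reduceFinMk]; linarith)
  rw [hc]
  refine Finset.sum_eq_zero fun k _ => Finset.sum_eq_zero fun l _ => ?_
  split_ifs with hkl
  · rfl
  · rw [hz k l hkl]; simp

/-- if `v ∈ 𝔒₃(T) = span{λᵢ²λⱼ : i ≠ j}` has vanishing moments
`∫_{Fᵢ} v λⱼ ds = 0` for all `i ≠ j`, then `v = 0`; in particular
`𝔒₃(T) ∩ 𝔅₃(T) = {0}`. -/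
theorem stmt19 (a : Fin 4 → E3) (hind : AffineIndependent ℝ a)
    (lam : Fin 4 → MvPolynomial (Fin 3) ℝ)
    (hdeg : ∀ i, (lam i).totalDegree ≤ 1)
    (hval : ∀ i j, evalP (a j) (lam i) = if i = j then 1 else 0) :
    (∀ v ∈ Submodule.span ℝ {w : MvPolynomial (Fin 3) ℝ |
        ∃ i j : Fin 4, i ≠ j ∧ w = lam i ^ 2 * lam j},
      (∀ i j : Fin 4, i ≠ j →
        ∫ x in face a i, evalP x v * evalP x (lam j) ∂(μH[2]) = 0) →
      v = 0) ∧
    (∀ v ∈ Submodule.span ℝ {w : MvPolynomial (Fin 3) ℝ |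
        ∃ i j : Fin 4, i ≠ j ∧ w = lam i ^ 2 * lam j},
      (∀ (i : Fin 4) (q : MvPolynomial (Fin 3) ℝ), q.totalDegree ≤ 1 →
        ∫ x in face a i, evalP x v * evalP x q ∂(μH[2]) = 0) →
      v = 0) := by
  refine ⟨fun v hv h => main_aux a lam hdeg hval v hv h, fun v hv h => ?_⟩
  exact main_aux a lam hdeg hval v hv fun i j _ => h i (lam j) (hdeg j)
end
end
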